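/- arXiv:1004.2482 — 5 statements merged into one kernel-verified Lean document; each statement's English description precedes it below -/
import Mathlib

section
/- There exists a constant C > 0 such that for all sufficiently large n, every strongly connected directed graph D on n vertices has cop number c(D) ≤ C · n · (log log n)² / log n. -/
/-!
Cops and Robbers on directed graphs.  A position consists of the cops'
locations (a function `Fin c → V`, so several cops may share a vertex) and the
robber's location.  In each round the cops move first, each along at most one
directed edge (or staying put); then the robber moves likewise.  `DCopsWin`
holds when the cops (moving first from the current position) can force a
capture in finitely many rounds.
-/

/-- A legal simultaneous move of the cops in a digraph: each cop stays put or
moves along one directed edge. -/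
def DCopMove {V : Type*} (D : Digraph V) {c : ℕ} (C C' : Fin c → V) : Prop :=
  ∀ i, C' i = C i ∨ D.Adj (C i) (C' i)

/-- `DCopsWin D c C r`: with cops at positions `C` and the robber at `r`,
and the cops to move, the `c` cops can force a capture. -/
inductive DCopsWin {V : Type*} (D : Digraph V) (c : ℕ) : (Fin c → V) → V → Prop
  | catch (C C' : Fin c → V) (r : V) (hm : DCopMove D C C') (i : Fin c)
      (hi : C' i = r) : DCopsWin D c C r
  | step (C C' : Fin c → V) (r : V) (hm : DCopMove D C C')
      (h : ∀ r', (r' = r ∨ D.Adj r r') → DCopsWin D c C' r') : DCopsWin D c C r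

/-- The cop number of a digraph: the least number of cops having a winning
strategy (first the cops choose starting positions, then the robber, knowing
them, chooses his starting vertex; then play proceeds with the cops moving
first). -/
noncomputable def dCopNumber {V : Type*} (D : Digraph V) : ℕ :=
  sInf {c : ℕ | ∃ C₀ : Fin c → V, ∀ r : V, DCopsWin D c C₀ r}

/-- A digraph is strongly connected if every vertex can reach every other
vertex by a directed path. -/
def Digraph.StronglyConnected {V : Type*} (D : Digraph V) : Prop :=
  ∀ u v : V, Relation.ReflTransGen D.Adj u v

namespace Digraph

variable {V : Type*} (D : Digraph V)

/-- `D.Reach j x y`: one can go from `x` to `y` in exactly `j` rounds, where in each round one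
stays put or follows an edge. -/
def Reach : ℕ → V → V → Prop
  | 0, x, y => x = y
  | j + 1, x, y => ∃ z, (z = x ∨ D.Adj x z) ∧ Reach j z y

variable {D}

theorem Reach.succ {j : ℕ} {x y : V} (h : D.Reach j x y) : D.Reach (j + 1) x y :=
  ⟨x, Or.inl rfl, h⟩

theorem Reach.mono {j l : ℕ} (hjl : j ≤ l) {x y : V} (h : D.Reach j x y) : D.Reach l x y := by
  induction hjl with
  | refl => exact h
  | step _ ih => exact ih.succ

theorem exists_reach_of_reflTransGen {x y : V} (h : Relation.ReflTransGen D.Adj x y) :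
    ∃ j, D.Reach j x y := by
  induction h using Relation.ReflTransGen.head_induction_on with
  | refl => exact ⟨0, rfl⟩
  | head hxz _ ih =>
    obtain ⟨j, hj⟩ := ih
    exact ⟨j + 1, _, Or.inr hxz, hj⟩

theorem StronglyConnected.exists_forall_reach (hD : D.StronglyConnected) {q : ℕ}
    (x y : Fin q → V) : ∃ N, ∀ l, D.Reach N (x l) (y l) := by
  choose f hf using fun l => exists_reach_of_reflTransGen (hD (x l) (y l))
  exact ⟨Finset.univ.sup f, fun l => (hf l).mono (Finset.le_sup (Finset.mem_univ l))⟩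

/-- Every vertex of `G` is occupied by one of the first `p` cops. -/
def Guarded {p q : ℕ} (G : Finset V) (C : Fin (p + q) → V) : Prop :=
  ∀ g ∈ G, ∃ i : Fin p, C (Fin.castAdd q i) = g

variable (D) in
/-- The cops win against a robber at `r` whenever the first `p` cops occupy `G`. -/
def Secured (p q : ℕ) (G : Finset V) (r : V) : Prop :=
  ∀ C : Fin (p + q) → V, Guarded G C → DCopsWin D (p + q) C r

variable (D) in
/-- The vertex `x` lies in the closed out-neighbourhood of `G`. -/
def Dominated (G : Finset V) (x : V) : Prop :=
  ∃ g ∈ G, x = g ∨ D.Adj g x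

theorem Dominated.mono {G G' : Finset V} (h : G ⊆ G') {x : V} (hx : D.Dominated G x) :
    D.Dominated G' x := by
  obtain ⟨g, hg, hx⟩ := hx
  exact ⟨g, h hg, hx⟩

theorem Dominated.secured {p q : ℕ} {G : Finset V} {r : V} (h : D.Dominated G r) :
    D.Secured p q G r := by
  classical
  intro C hC
  obtain ⟨g, hg, hr⟩ := h
  obtain ⟨i, hi⟩ := hC g hg
  refine DCopsWin.catch C (Function.update C (Fin.castAdd q i) r) r ?_ (Fin.castAdd q i) (by simp)
  intro l
  by_cases hl : l = Fin.castAdd q i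
  · subst hl
    simpa [hi] using hr
  · simp [hl]

/-- While the first `p` cops guard `G`, the others walk to their targets; the robber, confined to
`S i` after `i` rounds, is caught once the targets are reached. -/
theorem copsWin_of_targets {p q : ℕ} {G : Finset V} (S : ℕ → Finset V) (T : ℕ)
    (hS : ∀ i, ∀ r ∈ S i, D.Secured p q G r ∨
      ∀ r', (r' = r ∨ D.Adj r r') → r' ∈ S (i + 1) ∨ D.Secured p q G r')
    (y : Fin q → V)
    (hT : ∀ r ∈ S T, ∀ C : Fin (p + q) → V, Guarded G C →
      (∀ l, C (Fin.natAdd p l) = y l) → DCopsWin D (p + q) C r) :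
    ∀ (j i : ℕ) (C : Fin (p + q) → V) (r : V), i + j = T → Guarded G C →
      (∀ l, D.Reach j (C (Fin.natAdd p l)) (y l)) → r ∈ S i → DCopsWin D (p + q) C r := by
  intro j
  induction j with
  | zero =>
    intro i C r hij hC hR hr
    obtain rfl : i = T := by omega
    exact hT r hr C hC hR
  | succ j ih =>
    intro i C r hij hC hR hr
    rcases hS i r hr with h | h
    · exact h C hC
    choose z hz hz' using hR
    have hC' : Guarded G (Fin.append (fun i => C (Fin.castAdd q i)) z) := by
      intro g hg
      obtain ⟨i, hi⟩ := hC g hg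
      exact ⟨i, by simpa using hi⟩
    refine DCopsWin.step C (Fin.append (fun i => C (Fin.castAdd q i)) z) r ?_ ?_
    · intro l
      induction l using Fin.addCases with
      | left l => simp
      | right l => simpa using hz l
    · intro r' hr'
      rcases h r' hr' with h | h
      · exact ih (i + 1) _ r' (by omega) hC' (by simpa using hz') h
      · exact h _ hC'

/-- If the robber cannot leave `S` safely and the cops win once the free cops have reached some
fixed positions, then `S` is secured. -/
theorem StronglyConnected.secured_of_targets (hD : D.StronglyConnected) {p q : ℕ} {G : Finset V}
    (S : Finset V)
    (hS : ∀ r ∈ S, D.Secured p q G r ∨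
      ∀ r', (r' = r ∨ D.Adj r r') → r' ∈ S ∨ D.Secured p q G r')
    (y : Fin q → V)
    (hT : ∀ r ∈ S, ∀ C : Fin (p + q) → V, Guarded G C →
      (∀ l, C (Fin.natAdd p l) = y l) → DCopsWin D (p + q) C r) :
    ∀ r ∈ S, D.Secured p q G r := by
  intro r hr C hC
  obtain ⟨N, hN⟩ := hD.exists_forall_reach (fun l => C (Fin.natAdd p l)) y
  exact copsWin_of_targets (fun _ => S) N (fun _ => hS) y hT N 0 C r (by omega) hC hN hr

theorem exists_fin_surjOn {q : ℕ} [Nonempty V] {B : Finset V} (hB : B.card ≤ q) :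
    ∃ y : Fin q → V, ∀ r ∈ B, ∃ l, y l = r := by
  classical
  obtain ⟨v⟩ := ‹Nonempty V›
  refine ⟨fun l => if h : l.1 < B.card then (B.equivFin.symm ⟨l, h⟩ : V) else v, fun r hr => ?_⟩
  have := (B.equivFin ⟨r, hr⟩).2
  exact ⟨⟨B.equivFin ⟨r, hr⟩, by omega⟩, by simp⟩

theorem copsWin_of_occupied {c : ℕ} {C : Fin c → V} {r : V} (i : Fin c) (h : C i = r) :
    DCopsWin D c C r :=
  DCopsWin.catch C C r (fun _ => Or.inl rfl) i h

/-- If `B` has at most `q` vertices and every way out of `B` is secured, then so is `B`. -/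
theorem StronglyConnected.secured_of_card_le (hD : D.StronglyConnected) {p q : ℕ} {G : Finset V}
    (B : Finset V) (hB : B.card ≤ q)
    (hS : ∀ r ∈ B, D.Secured p q G r ∨
      ∀ r', (r' = r ∨ D.Adj r r') → r' ∈ B ∨ D.Secured p q G r') :
    ∀ r ∈ B, D.Secured p q G r := by
  intro r hr
  have : Nonempty V := ⟨r⟩
  obtain ⟨y, hy⟩ := exists_fin_surjOn hB
  refine hD.secured_of_targets B hS y (fun r hr C _ hC => ?_) r hr
  obtain ⟨l, hl⟩ := hy r hr
  exact copsWin_of_occupied (Fin.natAdd p l) (by rw [hC, hl])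

section Neighbourhoods

open Classical in
variable (D) in
/-- The closed out-neighbourhood of `A` within `R`. -/
noncomputable def outStep (R A : Finset V) : Finset V :=
  R.filter fun y => ∃ x ∈ A, y = x ∨ D.Adj x y

open Classical in
variable (D) in
/-- The closed in-neighbourhood of `A` within `R`. -/
noncomputable def inStep (R A : Finset V) : Finset V :=
  R.filter fun x => ∃ y ∈ A, y = x ∨ D.Adj x y

theorem mem_outStep {R A : Finset V} {y : V} :
    y ∈ D.outStep R A ↔ y ∈ R ∧ ∃ x ∈ A, y = x ∨ D.Adj x y := by
  simp [outStep]

theorem mem_inStep {R A : Finset V} {x : V} :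
    x ∈ D.inStep R A ↔ x ∈ R ∧ ∃ y ∈ A, y = x ∨ D.Adj x y := by
  simp [inStep]

theorem outStep_iterate_subset {R A : Finset V} (hA : A ⊆ R) (t : ℕ) :
    (D.outStep R)^[t] A ⊆ R := by
  cases t with
  | zero => exact hA
  | succ t =>
    rw [Function.iterate_succ_apply']
    exact fun x hx => (mem_outStep.1 hx).1

theorem inStep_iterate_subset {R A : Finset V} (hA : A ⊆ R) (t : ℕ) :
    (D.inStep R)^[t] A ⊆ R := by
  cases t with
  | zero => exact hA
  | succ t =>
    rw [Function.iterate_succ_apply']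
    exact fun x hx => (mem_inStep.1 hx).1

theorem subset_inStep {R A : Finset V} (hA : A ⊆ R) : A ⊆ D.inStep R A :=
  fun x hx => mem_inStep.2 ⟨hA hx, x, hx, Or.inl rfl⟩

theorem reach_of_mem_inStep_iterate {R : Finset V} {y : V} (t : ℕ) :
    ∀ x ∈ (D.inStep R)^[t] {y}, D.Reach t x y := by
  induction t with
  | zero => intro x hx; exact Finset.mem_singleton.1 hx
  | succ t ih =>
    intro x hx
    rw [Function.iterate_succ_apply'] at hx
    obtain ⟨_, z, hz, hxz⟩ := mem_inStep.1 hx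
    exact ⟨z, hxz, ih z hz⟩

theorem exists_mem_inStep_iterate_singleton {R A : Finset V} (t : ℕ) :
    ∀ x ∈ (D.inStep R)^[t] A, ∃ y ∈ A, x ∈ (D.inStep R)^[t] {y} := by
  induction t with
  | zero => intro x hx; exact ⟨x, hx, by simp⟩
  | succ t ih =>
    intro x hx
    rw [Function.iterate_succ_apply'] at hx
    obtain ⟨hxR, z, hz, hxz⟩ := mem_inStep.1 hx
    obtain ⟨y, hy, hzy⟩ := ih z hz
    refine ⟨y, hy, ?_⟩
    rw [Function.iterate_succ_apply']
    exact mem_inStep.2 ⟨hxR, z, hzy, hxz⟩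

theorem card_outStep_iterate_le {R : Finset V} {k : ℕ}
    (hk : ∀ v ∈ R, (D.outStep R {v}).card ≤ k) {v : V} (hv : v ∈ R) (t : ℕ) :
    ((D.outStep R)^[t] {v}).card ≤ k ^ t := by
  classical
  induction t with
  | zero => simp
  | succ t ih =>
    rw [Function.iterate_succ_apply']
    have hsub : D.outStep R ((D.outStep R)^[t] {v}) ⊆
        ((D.outStep R)^[t] {v}).biUnion fun x => D.outStep R {x} := by
      intro y hy
      obtain ⟨hyR, x, hx, hxy⟩ := mem_outStep.1 hy
      exact Finset.mem_biUnion.2 ⟨x, hx, mem_outStep.2 ⟨hyR, x, by simp, hxy⟩⟩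
    calc _ ≤ _ := Finset.card_le_card hsub
      _ ≤ ((D.outStep R)^[t] {v}).card * k := Finset.card_biUnion_le_card_mul _ _ _
          fun x hx => hk x (outStep_iterate_subset (by simpa using hv) t hx)
      _ ≤ k ^ (t + 1) := by rw [pow_succ]; gcongr

theorem expansion_inStep_iterate {R : Finset V} {k b : ℕ}
    (hR : ∀ B ⊆ R, B.Nonempty → B.card ≤ b → (k + 1) * B.card ≤ k * (D.inStep R B).card)
    {A : Finset V} (hA : A ⊆ R) (hA' : A.Nonempty) (t : ℕ) :
    ((D.inStep R)^[t] A).Nonempty ∧ (b ≤ ((D.inStep R)^[t] A).card ∨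
      (k + 1) ^ t * A.card ≤ k ^ t * ((D.inStep R)^[t] A).card) := by
  induction t with
  | zero => simpa using hA'
  | succ t ih =>
    rw [Function.iterate_succ_apply']
    obtain ⟨hne, ih⟩ := ih
    set B := (D.inStep R)^[t] A
    have hBR : B ⊆ R := inStep_iterate_subset hA t
    have hB := subset_inStep (D := D) hBR
    refine ⟨hne.mono hB, ?_⟩
    rcases le_total b B.card with hb | hb
    · exact Or.inl (hb.trans (Finset.card_le_card hB))
    · have h1 := hR B hBR hne hb
      rcases ih with ih | ih
      · exact Or.inl (ih.trans (Finset.card_le_card hB))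
      · right
        calc (k + 1) ^ (t + 1) * A.card = (k + 1) * ((k + 1) ^ t * A.card) := by ring
          _ ≤ (k + 1) * (k ^ t * B.card) := by gcongr
          _ = k ^ t * ((k + 1) * B.card) := by ring
          _ ≤ k ^ t * (k * (D.inStep R B).card) := by gcongr
          _ = _ := by ring

theorem two_mul_pow_self_le (k : ℕ) (hk : 0 < k) : 2 * k ^ k ≤ (k + 1) ^ k := by
  have h := one_add_mul_le_pow (a := (1 / k : ℝ)) (by have : (0 : ℝ) ≤ 1 / k := by positivity
                                                      linarith) k
  have hk' : (0 : ℝ) < k := by exact_mod_cast hk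
  rw [mul_one_div_cancel hk'.ne'] at h
  have h' : (2 : ℝ) * k ^ k ≤ (k + 1) ^ k :=
    calc (2 : ℝ) * k ^ k ≤ (1 + 1 / k) ^ k * k ^ k := by gcongr; linarith
      _ = (k + 1) ^ k := by rw [← mul_pow]; congr 1; field_simp
  exact_mod_cast h'

theorem card_inStep_iterate_ge {R : Finset V} {k s u : ℕ} (hk : 0 < k)
    (hR : ∀ B ⊆ R, B.Nonempty → B.card ≤ 2 ^ u * s →
      (k + 1) * B.card ≤ k * (D.inStep R B).card)
    {A : Finset V} (hA : A ⊆ R) (hA' : A.Nonempty) (hs : A.card ≤ s) :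
    2 ^ u * A.card ≤ ((D.inStep R)^[k * u] A).card := by
  rcases (expansion_inStep_iterate hR hA hA' (k * u)).2 with h | h
  · exact le_trans (by gcongr) h
  · have h2 : 2 ^ u * k ^ (k * u) ≤ (k + 1) ^ (k * u) := by
      rw [pow_mul, pow_mul, ← mul_pow]
      exact Nat.pow_le_pow_left (two_mul_pow_self_le k hk) u
    have h3 : k ^ (k * u) * (2 ^ u * A.card) ≤ k ^ (k * u) * ((D.inStep R)^[k * u] A).card :=
      calc _ = 2 ^ u * k ^ (k * u) * A.card := by ring
        _ ≤ (k + 1) ^ (k * u) * A.card := by gcongr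
        _ ≤ _ := h
    exact Nat.le_of_mul_le_mul_left h3 (by positivity)

end Neighbourhoods

section Probabilistic

variable [Fintype V]

/-- Union bound: a random map `Fin q → V` meets all sets of a family, provided the expected number
of missed sets is less than one. -/
theorem exists_forall_exists_mem [Nonempty V] {ι : Type*} (X : Finset ι) (F : ι → Finset V) (q : ℕ)
    (h : ∑ a ∈ X, Real.exp (-((F a).card * q / Fintype.card V)) < 1) :
    ∃ f : Fin q → V, ∀ a ∈ X, ∃ i, f i ∈ F a := by
  classical
  by_contra! hf
  set n := Fintype.card V with hn
  have hn0 : (0 : ℝ) < n := by exact_mod_cast Fintype.card_pos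
  have hcover : (Finset.univ : Finset (Fin q → V)) ⊆
      X.biUnion fun a => Fintype.piFinset fun _ : Fin q => (F a)ᶜ := by
    intro f _
    obtain ⟨a, ha, h⟩ := hf f
    exact Finset.mem_biUnion.2 ⟨a, ha, by simpa [Fintype.mem_piFinset] using h⟩
  have hcard := (Finset.card_le_card hcover).trans Finset.card_biUnion_le
  simp only [Finset.card_univ, Fintype.card_pi, Fintype.card_piFinset, Finset.prod_const,
    Fintype.card_fin, Finset.card_compl, ← hn] at hcard
  have hle : ∀ a ∈ X, (((n - (F a).card) ^ q : ℕ) : ℝ) ≤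
      n ^ q * Real.exp (-((F a).card * q / n)) := by
    intro a _
    have hc : (F a).card ≤ n := Finset.card_le_univ _
    have h1 : ((n - (F a).card : ℕ) : ℝ) ≤ n * Real.exp (-((F a).card / n)) := by
      rw [Nat.cast_sub hc]
      have := Real.add_one_le_exp (-((F a).card / n : ℝ))
      calc (n : ℝ) - (F a).card = n * (-((F a).card / n) + 1) := by field_simp; ring
        _ ≤ _ := by gcongr
    calc (((n - (F a).card) ^ q : ℕ) : ℝ) = ((n - (F a).card : ℕ) : ℝ) ^ q := by push_cast; rfl
      _ ≤ (n * Real.exp (-((F a).card / n))) ^ q := by gcongr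
      _ = _ := by rw [mul_pow, ← Real.exp_nat_mul]; congr 2; ring
  have hreal : (n : ℝ) ^ q ≤ ∑ a ∈ X, n ^ q * Real.exp (-((F a).card * q / n)) := by
    calc (n : ℝ) ^ q ≤ ∑ a ∈ X, (((n - (F a).card) ^ q : ℕ) : ℝ) := by exact_mod_cast hcard
      _ ≤ _ := Finset.sum_le_sum hle
  rw [← Finset.mul_sum] at hreal
  have : (0 : ℝ) < n ^ q := by positivity
  nlinarith

/-- If `N` expands small subsets of `R` by a large enough factor, then some `q` points
meet `N A` at least `A.card` times for all small `A ⊆ R`. -/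
theorem exists_forall_card_le_card_filter [DecidableEq V] {R : Finset V} {q s K : ℕ}
    (N : Finset V → Finset V) (hn : 2 ≤ Fintype.card V) (hK : 2 ≤ K)
    (hN : ∀ A ⊆ R, A.Nonempty → A.card ≤ s → K * A.card ≤ (N A).card)
    (hq : 8 * Fintype.card V * Real.log (Fintype.card V) ≤ K * q) :
    ∃ f : Fin q → V, ∀ A ⊆ R, A.card ≤ s →
      A.card ≤ (Finset.univ.filter fun i => f i ∈ N A).card := by
  set n := Fintype.card V with hn_def
  have hn0 : (0 : ℝ) < n := by positivity
  let X : Finset (Σ _ : ℕ, Finset V × Finset V) := (Finset.Icc 1 n).sigma fun a =>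
    ((Finset.powersetCard a R).filter fun A => A.card ≤ s) ×ˢ Finset.powersetCard a Finset.univ
  let F : (Σ _ : ℕ, Finset V × Finset V) → Finset V := fun x => N x.2.1 \ x.2.2
  have hsum : ∑ x ∈ X, Real.exp (-((F x).card * q / n)) < 1 := by
    have hterm : ∀ x ∈ X, Real.exp (-((F x).card * q / n)) ≤ ((n : ℝ) ^ (4 * x.1))⁻¹ := by
      rintro ⟨a, A, T⟩ hx
      simp only [X, Finset.mem_sigma, Finset.mem_Icc, Finset.mem_product, Finset.mem_filter,
        Finset.mem_powersetCard] at hx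
      obtain ⟨⟨ha, -⟩, ⟨⟨hAR, hA⟩, hAs⟩, -, hT⟩ := hx
      have hcard := hN A hAR (Finset.card_pos.1 (by omega)) hAs
      have h1 := Finset.le_card_sdiff T (N A)
      have h2 : K * a ≤ 2 * (F ⟨a, A, T⟩).card := by
        have : 2 * a ≤ K * a := by gcongr
        simp only [F]
        rw [hA] at hcard
        omega
      have h3 : (K * a : ℝ) ≤ 2 * (F ⟨a, A, T⟩).card := by exact_mod_cast h2
      have h4 : 4 * a * Real.log n ≤ (F ⟨a, A, T⟩).card * q / n := by
        rw [le_div_iff₀ hn0]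
        have h5 := mul_le_mul_of_nonneg_right h3 (Nat.cast_nonneg (α := ℝ) q)
        have h6 := mul_le_mul_of_nonneg_right hq (Nat.cast_nonneg (α := ℝ) a)
        linarith
      have h7 : ((n : ℝ) ^ (4 * a))⁻¹ = Real.exp (-(4 * a * Real.log n)) := by
        rw [Real.exp_neg, ← Real.exp_log hn0, ← Real.exp_nat_mul, Real.exp_log hn0]
        push_cast
        rfl
      simp only [h7]
      exact Real.exp_le_exp.2 (neg_le_neg h4)
    have hn2 : (2 : ℝ) ≤ n := by exact_mod_cast hn
    calc _ ≤ ∑ x ∈ X, ((n : ℝ) ^ (4 * x.1))⁻¹ := Finset.sum_le_sum hterm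
      _ ≤ ∑ a ∈ Finset.Icc 1 n, ((n : ℝ) ^ 2)⁻¹ := by
          rw [Finset.sum_sigma]
          refine Finset.sum_le_sum fun a ha => ?_
          have ha1 := (Finset.mem_Icc.1 ha).1
          simp only [Finset.sum_const, nsmul_eq_mul]
          have hc : (((Finset.powersetCard a R).filter fun A => A.card ≤ s) ×ˢ
              Finset.powersetCard a (Finset.univ : Finset V)).card ≤ n ^ (2 * a) := by
            rw [Finset.card_product, two_mul, pow_add]
            refine Nat.mul_le_mul ?_ ?_
            · refine (Finset.card_filter_le _ _).trans ?_
              rw [Finset.card_powersetCard]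
              exact (Nat.choose_le_pow _ _).trans
                (Nat.pow_le_pow_left (Finset.card_le_univ R) a)
            · rw [Finset.card_powersetCard, Finset.card_univ]
              exact Nat.choose_le_pow _ _
          have hc' : ((((Finset.powersetCard a R).filter fun A => A.card ≤ s) ×ˢ
              Finset.powersetCard a (Finset.univ : Finset V)).card : ℝ) ≤ (n : ℝ) ^ (2 * a) := by
            exact_mod_cast hc
          calc _ ≤ (n : ℝ) ^ (2 * a) * ((n : ℝ) ^ (4 * a))⁻¹ := by gcongr
            _ = ((n : ℝ) ^ (2 * a))⁻¹ := by
                rw [show 4 * a = 2 * a + 2 * a by ring, pow_add]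
                field_simp
            _ ≤ _ := by
                gcongr
                · linarith
                · omega
      _ = n * ((n : ℝ) ^ 2)⁻¹ := by simp
      _ < 1 := by
          rw [mul_inv_lt_iff₀ (by positivity)]
          nlinarith
  have : Nonempty V := Fintype.card_pos_iff.1 (by omega)
  obtain ⟨f, hf⟩ := exists_forall_exists_mem X F q hsum
  refine ⟨f, fun A hAR hAs => ?_⟩
  by_contra! hlt
  have hAn : A.card ≤ n := Finset.card_le_univ A
  obtain ⟨T, hIT, hT⟩ := Finset.exists_superset_card_eq
    (s := (Finset.univ.filter fun i => f i ∈ N A).image f)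
    (Finset.card_image_le.trans hlt.le) hAn
  obtain ⟨i, hi⟩ := hf ⟨A.card, A, T⟩ (by
    simp only [X, Finset.mem_sigma, Finset.mem_Icc, Finset.mem_product, Finset.mem_filter,
      Finset.mem_powersetCard]
    exact ⟨⟨by omega, hAn⟩, ⟨⟨hAR, trivial⟩, hAs⟩, Finset.subset_univ T, hT⟩)
  obtain ⟨hi1, hi2⟩ := Finset.mem_sdiff.1 hi
  exact hi2 (hIT (Finset.mem_image_of_mem f (by simpa using hi1)))

end Probabilistic

section Strategy

variable [Fintype V]

/-- A robber confined to a part `R` with small out-degrees and strong in-expansion is caught. -/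
theorem StronglyConnected.secured_of_expansion (hD : D.StronglyConnected) {p q k u : ℕ}
    {R G : Finset V} (hk : 0 < k) (hu : 0 < u) (hn : 2 ≤ Fintype.card V)
    (hout : ∀ v ∈ R, (D.outStep R {v}).card ≤ k)
    (hin : ∀ B ⊆ R, B.Nonempty → B.card ≤ 2 ^ u * k ^ (k * u) →
      (k + 1) * B.card ≤ k * (D.inStep R B).card)
    (hq : 8 * Fintype.card V * Real.log (Fintype.card V) ≤ (2 ^ u : ℕ) * q)
    (hG : ∀ x ∈ R, ∀ y ∉ R, D.Adj x y → D.Dominated G x ∨ D.Dominated G y) :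
    ∀ r ∈ R, D.Secured p q G r := by
  classical
  set t := k * u with ht
  have hesc : ∀ r ∈ R, D.Secured p q G r ∨
      ∀ r', (r' = r ∨ D.Adj r r') → r' ∈ R ∨ D.Secured p q G r' := by
    intro r hr
    by_cases hdom : D.Dominated G r
    · exact Or.inl hdom.secured
    · refine Or.inr fun r' hr' => ?_
      by_cases hr'R : r' ∈ R
      · exact Or.inl hr'R
      · rcases hr' with rfl | hadj
        · exact absurd hr hr'R
        · exact Or.inr ((hG r hr r' hr'R hadj).resolve_left hdom).secured
  obtain ⟨f, hf⟩ := exists_forall_card_le_card_filter (R := R) (q := q) (s := k ^ t)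
    (K := 2 ^ u) (D.inStep R)^[t] hn (Nat.le_self_pow hu.ne' 2)
    (fun A hA hA' hs => card_inStep_iterate_ge hk hin hA hA' hs) hq
  refine hD.secured_of_targets R hesc f fun v hv C hCG hC => ?_
  let S : ℕ → Finset V := fun i => (D.outStep R)^[i] {v}
  have hSR : ∀ i, S i ⊆ R := outStep_iterate_subset (by simpa using hv)
  have hcard : (S t).card ≤ k ^ t := card_outStep_iterate_le hout hv t
  obtain ⟨e, he, heN⟩ := (Finset.all_card_le_biUnion_card_iff_exists_injective
    (fun y : S t => Finset.univ.filter fun i => f i ∈ (D.inStep R)^[t] {(y : V)})).1 (by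
      intro A
      have hA : A.image Subtype.val ⊆ S t := by
        intro x hx
        obtain ⟨y, -, rfl⟩ := Finset.mem_image.1 hx
        exact y.2
      have h1 := hf (A.image Subtype.val) (hA.trans (hSR t))
        ((Finset.card_le_card hA).trans hcard)
      rw [Finset.card_image_of_injective _ Subtype.val_injective] at h1
      refine h1.trans (Finset.card_le_card fun i hi => ?_)
      obtain ⟨y, hy, hiy⟩ := exists_mem_inStep_iterate_singleton t (f i) (by simpa using hi)
      obtain ⟨z, hz, rfl⟩ := Finset.mem_image.1 hy
      exact Finset.mem_biUnion.2 ⟨z, hz, by simpa using hiy⟩)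
  let y : Fin q → V := fun l => if h : ∃ z : S t, e z = l then (h.choose : V) else f l
  have hy : ∀ z : S t, y (e z) = z := by
    intro z
    have h : ∃ z' : S t, e z' = e z := ⟨z, rfl⟩
    simp only [y, dif_pos h]
    rw [he h.choose_spec]
  refine copsWin_of_targets S t ?_ y ?_ t 0 C v (by omega) hCG ?_ (by simp [S])
  · intro i r hr
    refine (hesc r (hSR i hr)).imp_right fun h r' hr' => (h r' hr').imp_left fun hR => ?_
    simp only [S, Function.iterate_succ_apply']
    exact mem_outStep.2 ⟨hR, r, hr, hr'⟩
  · intro r hr C _ hC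
    exact copsWin_of_occupied (Fin.natAdd p (e ⟨r, hr⟩)) (by rw [hC, hy])
  · intro l
    rw [hC]
    by_cases h : ∃ z : S t, e z = l
    · obtain ⟨z, rfl⟩ := h
      rw [hy]
      exact reach_of_mem_inStep_iterate t _ (by simpa using heN z)
    · simp only [y, dif_neg h]
      exact Reach.mono (Nat.zero_le t) (rfl : D.Reach 0 (f l) (f l))

/-- Peeling off poorly expanding parts: `R.card / k` guards suffice to secure `R`. -/
theorem StronglyConnected.exists_guards (hD : D.StronglyConnected) {p q k u : ℕ}
    (hk : 0 < k) (hu : 0 < u) (hn : 2 ≤ Fintype.card V)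
    (hb : 2 ^ u * k ^ (k * u) ≤ q)
    (hq : 8 * Fintype.card V * Real.log (Fintype.card V) ≤ (2 ^ u : ℕ) * q) (R : Finset V) :
    ∃ G : Finset V, k * G.card ≤ R.card ∧ ∀ G', G ⊆ G' →
      (∀ x ∈ R, ∀ y ∉ R, D.Adj x y → D.Dominated G' x ∨ D.Dominated G' y) →
      ∀ r ∈ R, D.Secured p q G' r := by
  classical
  induction R using Finset.strongInduction with
  | H R ih =>
  by_cases hpeel : ∃ B ⊆ R, B.Nonempty ∧ B.card ≤ q ∧ ∃ H : Finset V, k * H.card ≤ B.card ∧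
      ∀ x ∈ R \ B, ∀ y ∈ B, D.Adj x y → D.Dominated H x ∨ D.Dominated H y
  · obtain ⟨B, hBR, hB, hBq, H, hHc, hH⟩ := hpeel
    obtain ⟨G, hGc, hG⟩ := ih (R \ B) (Finset.sdiff_ssubset hBR hB)
    refine ⟨G ∪ H, ?_, fun G' hG' hout => ?_⟩
    · have h1 := Finset.card_union_le G H
      have h2 := Finset.card_sdiff_add_card_eq_card hBR
      nlinarith
    have hrest := hG G' (Finset.union_subset_left hG') (by
      intro x hx y hy hxy
      by_cases hyB : y ∈ B
      · have hHG' : H ⊆ G' := Finset.union_subset_right hG'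
        exact (hH x hx y hyB hxy).imp (·.mono hHG') (·.mono hHG')
      · exact hout x (Finset.mem_sdiff.1 hx).1 y
          (fun hyR => hy (Finset.mem_sdiff.2 ⟨hyR, hyB⟩)) hxy)
    have hBsec := hD.secured_of_card_le (p := p) (q := q) (G := G') B hBq (by
      intro r hr
      by_cases hdom : D.Dominated G' r
      · exact Or.inl hdom.secured
      refine Or.inr fun r' hr' => ?_
      by_cases hr'B : r' ∈ B
      · exact Or.inl hr'B
      by_cases hr'R : r' ∈ R
      · exact Or.inr (hrest r' (Finset.mem_sdiff.2 ⟨hr'R, hr'B⟩))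
      · rcases hr' with rfl | hadj
        · exact absurd hr hr'B
        · exact Or.inr ((hout r (hBR hr) r' hr'R hadj).resolve_left hdom).secured)
    intro r hr
    by_cases hrB : r ∈ B
    · exact hBsec r hrB
    · exact hrest r (Finset.mem_sdiff.2 ⟨hr, hrB⟩)
  · push Not at hpeel
    refine ⟨∅, by simp, fun G' _ hout => ?_⟩
    refine hD.secured_of_expansion hk hu hn ?_ ?_ hq hout
    · intro v hv
      by_contra! hlt
      obtain ⟨B, hB, hBc⟩ := Finset.exists_subset_card_eq hlt.le
      have hkq : k ≤ q := by
        refine le_trans ?_ hb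
        calc k ≤ k ^ (k * u) := Nat.le_self_pow (by positivity) k
          _ ≤ _ := Nat.le_mul_of_pos_left _ (by positivity)
      obtain ⟨x, -, y, hy, -, -, h⟩ := hpeel B (fun y hy => (mem_outStep.1 (hB hy)).1)
        (Finset.card_pos.1 (by omega)) (by omega) {v} (by simp [hBc])
      obtain ⟨-, z, hz, hzy⟩ := mem_outStep.1 (hB hy)
      exact h ⟨z, hz, hzy⟩
    · intro B hBR hB hBc
      by_contra! hlt
      have hsub := subset_inStep (D := D) hBR
      have hcard := Finset.card_sdiff_add_card_eq_card hsub
      obtain ⟨x, hx, y, hy, hxy, h, -⟩ := hpeel B hBR hB (hBc.trans hb)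
        (D.inStep R B \ B) (by nlinarith)
      obtain ⟨hxR, hxB⟩ := Finset.mem_sdiff.1 hx
      exact h ⟨x, Finset.mem_sdiff.2 ⟨mem_inStep.2 ⟨hxR, y, hy, Or.inr hxy⟩, hxB⟩, Or.inl rfl⟩

theorem StronglyConnected.dCopNumber_le (hD : D.StronglyConnected) {p q k u : ℕ}
    (hk : 0 < k) (hu : 0 < u) (hn : 2 ≤ Fintype.card V)
    (hp : Fintype.card V / k ≤ p) (hb : 2 ^ u * k ^ (k * u) ≤ q)
    (hq : 8 * Fintype.card V * Real.log (Fintype.card V) ≤ (2 ^ u : ℕ) * q) :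
    dCopNumber D ≤ p + q := by
  obtain ⟨G, hGc, hG⟩ := hD.exists_guards (p := p) hk hu hn hb hq Finset.univ
  have : Nonempty V := Fintype.card_pos_iff.1 (by omega)
  have hGp : G.card ≤ p := by
    refine le_trans ?_ hp
    rw [Nat.le_div_iff_mul_le hk, mul_comm]
    exact hGc
  obtain ⟨y, hy⟩ := exists_fin_surjOn hGp
  refine Nat.sInf_le ⟨Fin.append y fun _ => Classical.arbitrary V, fun r => ?_⟩
  refine hG G subset_rfl (by simp) r (Finset.mem_univ r) _ fun g hg => ?_
  obtain ⟨i, hi⟩ := hy g hg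
  exact ⟨i, by simpa using hi⟩

end Strategy

end Digraph

/-- Every strongly connected digraph on `n` vertices has cop number at most
`O(n (log log n)^2 / log n)`. -/
theorem digraph_copNumber_upper_bound :
    ∃ C : ℝ, 0 < C ∧ ∃ N : ℕ, ∀ n : ℕ, N ≤ n →
      ∀ (V : Type) [Fintype V], Fintype.card V = n →
        ∀ D : Digraph V, D.StronglyConnected →
          (dCopNumber D : ℝ) ≤ C * n * (Real.log (Real.log n)) ^ 2 / Real.log n := by
  refine ⟨3072, by norm_num, 2 ^ 2 ^ 12, fun n hnN V _ hcard D hD => ?_⟩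
  subst hcard
  set n := Fintype.card V with hn
  have hn0 : n ≠ 0 := by
    have : 0 < 2 ^ 2 ^ 12 := by positivity
    omega
  obtain ⟨L, hL⟩ : ∃ L, L = Nat.log 2 n := ⟨_, rfl⟩
  have hL12 : 2 ^ 12 ≤ L := by
    rw [hL]; exact Nat.le_log_of_pow_le (by norm_num) hnN
  have hL1 : 2 ^ L ≤ n := by rw [hL]; exact Nat.pow_log_le_self 2 hn0
  have hL2 : n < 2 ^ (L + 1) := by rw [hL]; exact Nat.lt_pow_succ_log_self (by norm_num) n
  obtain ⟨l, hl⟩ : ∃ l, l = Nat.log 2 L := ⟨_, rfl⟩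
  have hl12 : 12 ≤ l := by rw [hl]; exact Nat.le_log_of_pow_le (by norm_num) hL12
  have hl1 : 2 ^ l ≤ L := by rw [hl]; exact Nat.pow_log_le_self 2 (by omega)
  have hl2 : L < 2 ^ (l + 1) := by rw [hl]; exact Nat.lt_pow_succ_log_self (by norm_num) L
  clear hL hl
  have hl16 : 16 * l ^ 2 ≤ 2 ^ l := by
    clear hl1 hl2
    induction l, hl12 using Nat.le_induction with
    | base => norm_num
    | succ l hl ih => rw [pow_succ 2 l]; nlinarith
  obtain ⟨k, hk⟩ : ∃ k, k = L / (16 * l ^ 2) := ⟨_, rfl⟩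
  have hk0 : 0 < k := by
    rw [hk]; exact Nat.div_pos (hl16.trans hl1) (by positivity)
  have hkL : k * (16 * l ^ 2) ≤ L := by rw [hk]; exact Nat.div_mul_le_self _ _
  have hkL' : L < (k + 1) * (16 * l ^ 2) := by
    rw [hk, mul_comm]; exact Nat.lt_mul_div_succ L (by positivity)
  clear hk
  have hkl : k ≤ 2 ^ (l + 1) := by nlinarith
  have hn2 : 2 ≤ n := by
    calc 2 = 2 ^ 1 := rfl
      _ ≤ 2 ^ L := Nat.pow_le_pow_right (by norm_num) (by omega)
      _ ≤ n := hL1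
  have hlog : Real.log n ≤ L + 1 := by
    have h1 : (n : ℝ) ≤ 2 ^ (L + 1) := by exact_mod_cast hL2.le
    have h2 := Real.log_le_log (by positivity) h1
    rw [Real.log_pow] at h2
    push_cast at h2
    have := Real.log_two_lt_d9
    nlinarith [Nat.cast_nonneg (α := ℝ) L]
  have hsize : 2 ^ (3 * l) * k ^ (k * (3 * l)) * k ≤ n := by
    calc _ = 2 ^ (3 * l) * k ^ (k * (3 * l) + 1) := by ring
      _ ≤ 2 ^ (3 * l) * (2 ^ (l + 1)) ^ (k * (3 * l) + 1) := by gcongr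
      _ = 2 ^ (3 * l + (l + 1) * (k * (3 * l) + 1)) := by rw [← pow_mul, ← pow_add]
      _ ≤ 2 ^ L := by
        apply Nat.pow_le_pow_right (by norm_num)
        refine le_trans ?_ hkL
        have h1 : l ≤ l ^ 2 := by nlinarith
        have h2 : l ^ 2 ≤ k * l ^ 2 := Nat.le_mul_of_pos_left _ hk0
        have h3 : k * l ≤ k * l ^ 2 := by gcongr
        nlinarith
      _ ≤ n := hL1
  have hdiv : n < k * (n / k + 1) := by
    exact Nat.lt_mul_div_succ n hk0
  have hcop := hD.dCopNumber_le (p := n / k) (q := n / k + 1) (k := k) (u := 3 * l) hk0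
    (by omega) hn2 le_rfl
    (((Nat.le_div_iff_mul_le hk0).2 hsize).trans (Nat.le_succ _)) (by
      have h1 : (L : ℝ) + 1 ≤ 2 ^ (l + 1) := by exact_mod_cast hl2
      have h2 : (k : ℝ) ≤ 2 ^ (l + 1) := by exact_mod_cast hkl
      have h3 : (n : ℝ) ≤ k * ((n / k + 1 : ℕ) : ℝ) := by exact_mod_cast hdiv.le
      have h4 : (8 * (2 ^ (l + 1) * 2 ^ (l + 1)) : ℝ) ≤ (2 ^ (3 * l) : ℕ) := by
        have : 8 * (2 ^ (l + 1) * 2 ^ (l + 1)) ≤ 2 ^ (3 * l) := by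
          calc 8 * (2 ^ (l + 1) * 2 ^ (l + 1)) = 2 ^ (3 + (l + 1 + (l + 1))) := by
                ring
            _ ≤ _ := Nat.pow_le_pow_right (by norm_num) (by omega)
        exact_mod_cast this
      calc 8 * (n : ℝ) * Real.log n
          ≤ 8 * (2 ^ (l + 1) * ((n / k + 1 : ℕ) : ℝ)) * 2 ^ (l + 1) := by
            have : 0 ≤ Real.log n := Real.log_natCast_nonneg n
            gcongr
            · exact h3.trans (by gcongr)
            · exact hlog.trans h1
        _ = 8 * (2 ^ (l + 1) * 2 ^ (l + 1)) * ((n / k + 1 : ℕ) : ℝ) := by ring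
        _ ≤ _ := by gcongr)
  have hkn : k ≤ n := by
    refine le_trans ?_ hsize
    exact Nat.le_mul_of_pos_left _ (by positivity)
  have hcop' : k * dCopNumber D ≤ 3 * n := by
    have := Nat.div_mul_le_self n k
    nlinarith
  have hLlog : (L : ℝ) ≤ 2 * Real.log n := by
    have h1 : (2 : ℝ) ^ L ≤ n := by exact_mod_cast hL1
    have h2 := Real.log_le_log (by positivity) h1
    rw [Real.log_pow] at h2
    have := Real.log_two_gt_d9
    nlinarith [Nat.cast_nonneg (α := ℝ) L]
  have hL12' : (4096 : ℝ) ≤ L := by exact_mod_cast hL12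
  have hlogpos : 0 < Real.log n := by linarith
  have hloglog : 1 ≤ Real.log (Real.log n) := by
    rw [Real.le_log_iff_exp_le hlogpos]
    have := Real.exp_one_lt_d9
    linarith
  have hllog : (l : ℝ) ≤ 4 * Real.log (Real.log n) := by
    have h1 : (2 : ℝ) ^ l ≤ 2 * Real.log n := le_trans (by exact_mod_cast hl1) hLlog
    have h2 := Real.log_le_log (by positivity) h1
    rw [Real.log_pow, Real.log_mul (by norm_num) hlogpos.ne'] at h2
    have := Real.log_two_gt_d9
    have := Real.log_two_lt_d9
    nlinarith [Nat.cast_nonneg (α := ℝ) l]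
  have hfin : Real.log n ≤ 1024 * (k * Real.log (Real.log n) ^ 2) := by
    have h1 : L ≤ 32 * (k * l ^ 2) := by nlinarith [Nat.zero_le (l ^ 2)]
    have h2 : (L : ℝ) ≤ 32 * (k * l ^ 2) := by exact_mod_cast h1
    have h3 : (k : ℝ) * l ^ 2 ≤ k * (4 * Real.log (Real.log n)) ^ 2 := by gcongr
    nlinarith
  rw [le_div_iff₀ hlogpos]
  have hcopR : (k : ℝ) * dCopNumber D ≤ 3 * n := by exact_mod_cast hcop'
  calc (dCopNumber D : ℝ) * Real.log n
      ≤ dCopNumber D * (1024 * (k * Real.log (Real.log n) ^ 2)) := by gcongr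
    _ = 1024 * Real.log (Real.log n) ^ 2 * (k * dCopNumber D) := by ring
    _ ≤ 1024 * Real.log (Real.log n) ^ 2 * (3 * n) := by gcongr
    _ = _ := by ring
end

section
/- For every ε > 0 there exists N such that every connected graph G on n ≥ N vertices has cop number c(G) ≤ n / 2^{(1-ε)·√(log₂ n)}. -/
/-!
Classical Cops and Robbers on an undirected graph.  Cops are placed first
(several may share a vertex), then the robber, knowing the cops' positions,
chooses a starting vertex; thereafter cops and robber move in alternate
rounds, cops first, each player moving to an adjacent vertex or staying put.
The cops win if at some point a cop occupies the robber's vertex.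
-/

/-- A legal simultaneous move of the cops: each cop stays put or moves to an
adjacent vertex. -/
def CopMove {V : Type*} (G : SimpleGraph V) {c : ℕ} (C C' : Fin c → V) : Prop :=
  ∀ i, C' i = C i ∨ G.Adj (C i) (C' i)

/-- `CopsWin G c C r`: with cops at positions `C`, the robber at `r`, and the
cops to move, the `c` cops can force a capture. -/
inductive CopsWin {V : Type*} (G : SimpleGraph V) (c : ℕ) : (Fin c → V) → V → Prop
  | catch (C C' : Fin c → V) (r : V) (hm : CopMove G C C') (i : Fin c)
      (hi : C' i = r) : CopsWin G c C r
  | step (C C' : Fin c → V) (r : V) (hm : CopMove G C C')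
      (h : ∀ r', (r' = r ∨ G.Adj r r') → CopsWin G c C' r') : CopsWin G c C r

/-- The cop number of a graph: the least number of cops having a winning
strategy. -/
noncomputable def copNumber {V : Type*} (G : SimpleGraph V) : ℕ :=
  sInf {c : ℕ | ∃ C₀ : Fin c → V, ∀ r : V, CopsWin G c C₀ r}

open Finset

section Game

variable {V : Type*} {G : SimpleGraph V} {c : ℕ}

/-- A single legal move of one player: stay put or move to an adjacent vertex. -/
def StepTo (G : SimpleGraph V) (a b : V) : Prop := b = a ∨ G.Adj a b

theorem StepTo.refl (a : V) : StepTo G a a := Or.inl rfl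

theorem StepTo.symm {a b : V} (h : StepTo G a b) : StepTo G b a :=
  h.elim (fun h => Or.inl h.symm) (fun h => Or.inr h.symm)

/-- With cops at `C`, the robber at `r`, and the robber to move, the cops can force a capture. -/
def RobberLoses (G : SimpleGraph V) (C : Fin c → V) (r : V) : Prop :=
  ∀ r', StepTo G r r' → CopsWin G c C r'

theorem CopsWin.of_stepTo {C : Fin c → V} {r : V} (i : Fin c) (h : StepTo G (C i) r) :
    CopsWin G c C r := by
  classical
  refine CopsWin.catch C (Function.update C i r) r (fun j => ?_) i (by simp)
  by_cases hj : j = i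
  · subst hj
    simpa [StepTo] using h
  · simp [hj]

/-- The cops in `K` confine the robber to the territory `H`: as long as each cop `i ∈ K` occupies
the shadow `σ i r` of the robber's position `r`, it can follow that shadow, and a robber leaving
`H` is caught at once. -/
structure Guarding (G : SimpleGraph V) (H : Finset V) (K : Finset (Fin c))
    (σ : Fin c → V → V) : Prop where
  follow : ∀ i ∈ K, ∀ r ∈ H, ∀ r' ∈ H, StepTo G r r' → StepTo G (σ i r) (σ i r')
  boundary : ∀ r ∈ H, ∀ r' ∉ H, StepTo G r r' → ∃ i ∈ K, StepTo G (σ i r) r'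

/-- The robber is in `H` and each guard is on its shadow. -/
def InPosition (H : Finset V) (K : Finset (Fin c)) (σ : Fin c → V → V) (C : Fin c → V)
    (r : V) : Prop :=
  r ∈ H ∧ ∀ i ∈ K, C i = σ i r

variable {H : Finset V} {K : Finset (Fin c)} {σ : Fin c → V → V}

/-- It suffices to prescribe the moves of the free cops against robber moves inside `H`. -/
theorem Guarding.robberLoses_of_free_move (hG : Guarding G H K σ) {C : Fin c → V} {r : V}
    (hp : InPosition H K σ C r)
    (h : ∀ r' ∈ H, StepTo G r r' → CopsWin G c C r' ∨ ∃ X : Fin c → V,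
      (∀ i ∉ K, StepTo G (C i) (X i)) ∧
        ∀ C', InPosition H K σ C' r' → (∀ i ∉ K, C' i = X i) → RobberLoses G C' r') :
    RobberLoses G C r := by
  classical
  intro r' hr'
  by_cases hH : r' ∈ H
  · obtain h | ⟨X, hX, hw⟩ := h r' hH hr'
    · exact h
    · refine CopsWin.step C (fun i => if i ∈ K then σ i r' else X i) r' (fun i => ?_)
        (hw _ ⟨hH, fun i hi => by simp [hi]⟩ (fun i hi => by simp [hi]))
      by_cases hi : i ∈ K
      · simpa [hi, hp.2 i hi, StepTo] using hG.follow i hi r hp.1 r' hH hr'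
      · simpa [hi, StepTo] using hX i hi
  · obtain ⟨i, hi, hs⟩ := hG.boundary r hp.1 r' hH hr'
    exact CopsWin.of_stepTo i (hp.2 i hi ▸ hs)

/-- Positions which a robber starting at `v` can occupy at a given time without leaving `H` and
without having been met by a cop outside `K` following the schedule `X`. -/
def evaders (G : SimpleGraph V) (H : Finset V) (K : Finset (Fin c)) (X : ℕ → Fin c → V) (v : V) :
    ℕ → Set V
  | 0 => {v}
  | n + 1 => {r' | r' ∈ H ∧ (∃ r ∈ evaders G H K X v n, StepTo G r r') ∧ ∀ i ∉ K, X (n + 1) i ≠ r'}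

theorem evaders_subset {X : ℕ → Fin c → V} {v : V} (hv : v ∈ H) :
    ∀ n, ∀ r ∈ evaders G H K X v n, r ∈ H
  | 0, _, hr => hr ▸ hv
  | _ + 1, _, hr => hr.1

/-- The free cops may follow any schedule fixed in advance. -/
theorem Guarding.robberLoses_of_schedule (hG : Guarding G H K σ) {X : ℕ → Fin c → V}
    (hX : ∀ n, ∀ i ∉ K, StepTo G (X n i) (X (n + 1) i)) {v : V} (T : ℕ)
    (hend : ∀ C r, r ∈ evaders G H K X v T → InPosition H K σ C r →
      (∀ i ∉ K, C i = X T i) → RobberLoses G C r)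
    {C : Fin c → V} (hp : InPosition H K σ C v) (hC : ∀ i ∉ K, C i = X 0 i) :
    RobberLoses G C v := by
  have key : ∀ k n, n + k = T → ∀ C r, r ∈ evaders G H K X v n → InPosition H K σ C r →
      (∀ i ∉ K, C i = X n i) → RobberLoses G C r := by
    intro k
    induction k with
    | zero => rintro n rfl; exact hend
    | succ k ih =>
      intro n hn C r hr hp hC
      refine hG.robberLoses_of_free_move hp fun r' hH hs => ?_
      by_cases hc : ∃ i ∉ K, X (n + 1) i = r'
      · obtain ⟨i, hi, rfl⟩ := hc
        exact Or.inl (CopsWin.of_stepTo i (hC i hi ▸ hX n i hi))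
      · push Not at hc
        exact Or.inr ⟨X (n + 1), fun i hi => hC i hi ▸ hX n i hi, fun C' hp' hC' =>
          ih (n + 1) (by omega) C' r' ⟨hH, ⟨r, hr, hs⟩, hc⟩ hp' hC'⟩
  exact key T 0 (by simp) C v rfl hp hC

theorem SimpleGraph.Walk.stepTo_getVert {u v : V} (p : G.Walk u v) (n : ℕ) :
    StepTo G (p.getVert n) (p.getVert (n + 1)) := by
  by_cases h : n < p.length
  · exact Or.inr (p.adj_getVert_succ h)
  · left
    rw [p.getVert_of_length_le (by omega), p.getVert_of_length_le (by omega)]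

/-- The free cops may first take any positions they like. -/
theorem Guarding.robberLoses_of_reposition (hG : Guarding G H K σ) (hconn : G.Connected)
    (Y : Fin c → V)
    (hend : ∀ C r, InPosition H K σ C r → (∀ i ∉ K, C i = Y i) → RobberLoses G C r)
    {C : Fin c → V} {r : V} (hp : InPosition H K σ C r) : RobberLoses G C r := by
  have p := fun i => (hconn (C i) (Y i)).some
  refine hG.robberLoses_of_schedule (X := fun n i => (p i).getVert n)
    (fun n i _ => (p i).stepTo_getVert n) (univ.sup fun i => (p i).length)
    (fun C' r' _ hp' hC' => hend C' r' hp' fun i hi => ?_) hp (by simp)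
  rw [hC' i hi, SimpleGraph.Walk.getVert_of_length_le]
  exact le_sup (f := fun i => (p i).length) (mem_univ i)

/-- A free cop can catch up with a shadow moving along a path. -/
theorem Guarding.robberLoses_of_chase (hG : Guarding G H K σ) {γ : ℕ → V} {φ : V → ℕ}
    (hγ : ∀ n, StepTo G (γ n) (γ (n + 1)))
    (hφ : ∀ r ∈ H, ∀ r' ∈ H, StepTo G r r' → φ r' ≤ φ r + 1) {i : Fin c} (hi : i ∉ K)
    (hend : ∀ C r, InPosition H K σ C r → C i = γ (φ r) → RobberLoses G C r)
    {C : Fin c → V} {r : V} (hp : InPosition H K σ C r) (h0 : C i = γ 0) :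
    RobberLoses G C r := by
  classical
  have key : ∀ k j, H.sup φ ≤ j + k → ∀ C r, InPosition H K σ C r → C i = γ j → j ≤ φ r →
      RobberLoses G C r := by
    intro k
    induction k with
    | zero =>
      intro j hj C r hp hC hle
      have := le_sup (f := φ) hp.1
      exact hend C r hp (by rw [hC]; congr 1; omega)
    | succ k ih =>
      intro j hj C r hp hC hle
      refine hG.robberLoses_of_free_move hp fun r' hH hs => Or.inr ?_
      have h1 := hφ r' hH r hp.1 hs.symm
      by_cases hc : φ r' ≤ j + 1
      · refine ⟨Function.update C i (γ (φ r')), fun l hl => ?_, fun C' hp' hC' =>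
          hend C' r' hp' (by simpa using hC' i hi)⟩
        by_cases hli : l = i
        · subst hli
          obtain h | h | h : φ r' + 1 = j ∨ φ r' = j ∨ φ r' = j + 1 := by omega
          · simpa [hC, ← h] using (hγ (φ r')).symm
          · simpa [hC, h] using StepTo.refl _
          · simpa [hC, h] using hγ j
        · simpa [hli] using StepTo.refl _
      · refine ⟨Function.update C i (γ (j + 1)), fun l hl => ?_, fun C' hp' hC' =>
          ih (j + 1) (by omega) C' r' hp' (by simpa using hC' i hi) (by omega)⟩
        by_cases hli : l = i
        · subst hli
          simpa [hC] using hγ j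
        · simpa [hli] using StepTo.refl _
  exact key (H.sup φ) 0 (by simp) C r hp h0 (Nat.zero_le _)

end Game

section Territory

variable {V : Type*} {G : SimpleGraph V} {c : ℕ}

/-- The graph on all vertices whose edges are the edges of `G` inside `H`. -/
def SimpleGraph.within (G : SimpleGraph V) (H : Finset V) : SimpleGraph V where
  Adj a b := G.Adj a b ∧ a ∈ H ∧ b ∈ H
  symm := ⟨fun _ _ h => ⟨h.1.symm, h.2.2, h.2.1⟩⟩
  loopless := ⟨fun _ h => h.1.ne rfl⟩

theorem SimpleGraph.within_le (H : Finset V) : G.within H ≤ G := fun _ _ h => h.1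

theorem StepTo.mono {G' : SimpleGraph V} (h : G' ≤ G) {a b : V} (hs : StepTo G' a b) :
    StepTo G a b :=
  hs.imp_right fun h' => h h'

/-- Any two vertices of `H` are joined by a path inside `H`. -/
def Linked (G : SimpleGraph V) (H : Finset V) : Prop :=
  ∀ u ∈ H, ∀ v ∈ H, (G.within H).Reachable u v

open Classical in
/-- The vertices of `S` that can be reached from `r` inside `S`. -/
noncomputable def SimpleGraph.component (G : SimpleGraph V) (S : Finset V) (r : V) : Finset V :=
  {v ∈ S | (G.within S).Reachable r v}

theorem SimpleGraph.component_subset (S : Finset V) (r : V) : G.component S r ⊆ S := by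
  classical exact filter_subset _ _

theorem SimpleGraph.mem_component {S : Finset V} {r v : V} :
    v ∈ G.component S r ↔ v ∈ S ∧ (G.within S).Reachable r v := by
  simp [SimpleGraph.component]

theorem SimpleGraph.mem_component_of_stepTo {S : Finset V} {r v w : V} (hv : v ∈ G.component S r)
    (hw : w ∈ S) (h : StepTo G v w) : w ∈ G.component S r := by
  rw [mem_component] at *
  obtain rfl | h := h
  · exact hv
  · refine ⟨hw, hv.2.trans (SimpleGraph.Adj.reachable ?_)⟩
    exact ⟨h, hv.1, hw⟩

theorem SimpleGraph.linked_component (S : Finset V) (r : V) : Linked G (G.component S r) := by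
  have key : ∀ v ∈ G.component S r, (G.within (G.component S r)).Reachable r v := by
    intro v hv
    have hr := (mem_component.1 hv).2
    rw [reachable_iff_reflTransGen] at hr
    clear hv
    induction hr with
    | refl => exact Reachable.refl _
    | @tail b d hb hbd ih =>
      have hbc : b ∈ G.component S r :=
        mem_component.2 ⟨hbd.2.1, (reachable_iff_reflTransGen _ _).2 hb⟩
      refine ih.trans (Adj.reachable ?_)
      exact ⟨hbd.1, hbc, mem_component_of_stepTo hbc hbd.2.2 (Or.inr hbd.1)⟩
  exact fun u hu v hv => (key u hu).symm.trans (key v hv)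

variable {H : Finset V} {K : Finset (Fin c)} {σ : Fin c → V → V}

theorem Linked.dist_le_dist_add_one (hH : Linked G H) {u r r' : V} (hu : u ∈ H) (hr : r ∈ H)
    (hr' : r' ∈ H) (hs : StepTo G r r') :
    (G.within H).dist u r' ≤ (G.within H).dist u r + 1 := by
  obtain rfl | h := hs
  · exact Nat.le_succ _
  · obtain ⟨p, hp⟩ := (hH u hu r hr).exists_walk_length_eq_dist
    have hadj : (G.within H).Adj r r' := ⟨h, hr, hr'⟩
    simpa [hp] using SimpleGraph.dist_le (p.concat hadj)

open Classical in
/-- Once a free cop is on the shadow of the robber in `P`, it becomes a guard and the territory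
shrinks to a component of `H \ P`. -/
theorem Guarding.insert_guard (hG : Guarding G H K σ) {i : Fin c} (hi : i ∉ K) {P : Finset V}
    {s : V → V} (hs : ∀ r ∈ H, ∀ r' ∈ H, StepTo G r r' → StepTo G (s r) (s r'))
    (hP : ∀ r ∈ H, ∀ r' ∈ P, StepTo G r r' → StepTo G (s r) r') (r : V) :
    Guarding G (G.component (H \ P) r) (insert i K) (Function.update σ i s) := by
  have hsub : G.component (H \ P) r ⊆ H := (G.component_subset _ _).trans sdiff_subset
  constructor
  · intro j hj v hv w hw h
    by_cases hji : j = i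
    · subst hji
      simpa using hs v (hsub hv) w (hsub hw) h
    · simpa [hji] using hG.follow j (by simpa [hji] using hj) v (hsub hv) w (hsub hw) h
  · intro v hv w hw h
    by_cases hwH : w ∈ H
    · by_cases hwP : w ∈ P
      · exact ⟨i, by simp, by simpa using hP v (hsub hv) w hwP h⟩
      · exact absurd (G.mem_component_of_stepTo hv (by simp [hwH, hwP]) h) hw
    · obtain ⟨j, hj, hs⟩ := hG.boundary v (hsub hv) w hwH h
      have hji : j ≠ i := fun h => hi (h ▸ hj)
      exact ⟨j, by simp [hj], by simpa [hji] using hs⟩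

open Classical in
/-- If the cops win on territories of small diameter and small degrees using `M` free cops, then
they win on a territory `H` using `#H / D` more. -/
theorem Guarding.robberLoses_of_endgame [Fintype V] (hconn : G.Connected) {D M : ℕ} (hD : 0 < D)
    (hend : ∀ (H : Finset V) (K : Finset (Fin c)) (σ : Fin c → V → V), Guarding G H K σ →
      Linked G H → (∀ v ∈ H, ∀ w ∈ H, (G.within H).dist v w < D) →
      (∀ v ∈ H, #{w ∈ H | StepTo G v w} < D) → M ≤ #Kᶜ →
      ∀ C r, InPosition H K σ C r → RobberLoses G C r)
    (hG : Guarding G H K σ) (hH : Linked G H) (hc : #H / D + M ≤ #Kᶜ)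
    {C : Fin c → V} {r : V} (hp : InPosition H K σ C r) : RobberLoses G C r := by
  induction hn : #H using Nat.strong_induction_on generalizing H K σ C r with
  | _ n ih =>
  subst hn
  have key : ∀ (γ : ℕ → V) (φ : V → ℕ) (P : Finset V), (∀ n, StepTo G (γ n) (γ (n + 1))) →
      (∀ r ∈ H, ∀ r' ∈ H, StepTo G r r' → φ r' ≤ φ r + 1) → P ⊆ H → D ≤ #P →
      (∀ r ∈ H, ∀ r' ∈ P, StepTo G r r' → StepTo G (γ (φ r)) r') → RobberLoses G C r := by
    intro γ φ P hγ hφ hPH hPD hP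
    have hDH : D ≤ #H := hPD.trans (card_le_card hPH)
    have hpos : 0 < #H / D := Nat.div_pos hDH hD
    obtain ⟨i, hi⟩ : (Kᶜ).Nonempty := card_pos.1 (by omega)
    have hiK : i ∉ K := by simpa using hi
    have hs : ∀ r ∈ H, ∀ r' ∈ H, StepTo G r r' → StepTo G (γ (φ r)) (γ (φ r')) := by
      intro r hr r' hr' h
      have h1 := hφ r hr r' hr' h
      have h2 := hφ r' hr' r hr h.symm
      obtain h | h | h : φ r' + 1 = φ r ∨ φ r' = φ r ∨ φ r' = φ r + 1 := by omega
      · exact h ▸ (hγ _).symm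
      · exact h ▸ StepTo.refl _
      · exact h ▸ hγ _
    refine hG.robberLoses_of_reposition hconn (fun _ => γ 0) (fun C₁ r₁ hp₁ hC₁ => ?_) hp
    refine hG.robberLoses_of_chase hγ hφ hiK (fun C₂ r₂ hp₂ hC₂ => ?_) hp₁ (hC₁ i hiK)
    refine hG.robberLoses_of_free_move hp₂ fun r₃ hr₃ h₃ => ?_
    by_cases hrP : r₃ ∈ P
    · exact Or.inl (CopsWin.of_stepTo i (hC₂ ▸ hP r₂ hp₂.1 r₃ hrP h₃))
    refine Or.inr ⟨Function.update C₂ i (γ (φ r₃)), fun j _ => ?_, fun C₄ hp₄ hC₄ => ?_⟩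
    · by_cases hji : j = i
      · subst hji
        simpa [hC₂] using hs _ hp₂.1 _ hr₃ h₃
      · simpa [hji] using StepTo.refl _
    have hcard : #(G.component (H \ P) r₃) + D ≤ #H := by
      have h1 := card_le_card (G.component_subset (H \ P) r₃)
      have h2 := card_sdiff_add_card_eq_card hPH
      omega
    have hdiv : #(G.component (H \ P) r₃) / D + 1 ≤ #H / D := by
      rw [← Nat.add_div_right _ hD]
      exact Nat.div_le_div_right hcard
    refine ih _ (by omega) (hG.insert_guard hiK hs hP r₃) (G.linked_component _ _) ?_
      ⟨G.mem_component.2 ⟨by simp [hr₃, hrP], .refl _⟩, fun j hj => ?_⟩ rfl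
    · have h1 : #(insert i K)ᶜ + 1 = #Kᶜ := by
        rw [compl_insert, card_erase_add_one hi]
      omega
    · by_cases hji : j = i
      · subst hji
        simpa using hC₄ j hiK
      · simpa [hji] using hp₄.2 j (by simpa [hji] using hj)
  by_cases hdist : ∀ v ∈ H, ∀ w ∈ H, (G.within H).dist v w < D
  · by_cases hdeg : ∀ v ∈ H, #{w ∈ H | StepTo G v w} < D
    · exact hend H K σ hG hH hdist hdeg (le_of_add_le_right hc) C r hp
    · push Not at hdeg
      obtain ⟨v, _, hvD⟩ := hdeg
      exact key (fun _ => v) (fun _ => 0) _ (fun _ => .refl _) (by simp) (filter_subset _ _) hvD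
        (fun _ _ r' hr' _ => (mem_filter.1 hr').2)
  · push Not at hdist
    obtain ⟨u, hu, w, hw, hD'⟩ := hdist
    obtain ⟨p, hp'⟩ := (hH u hu w hw).exists_walk_length_eq_dist
    have hφ : ∀ r ∈ H, ∀ r' ∈ H, StepTo G r r' →
        (G.within H).dist u r' ≤ (G.within H).dist u r + 1 :=
      fun r hr r' hr' => hH.dist_le_dist_add_one hu hr hr'
    have hγ : ∀ n, StepTo G (p.getVert n) (p.getVert (n + 1)) :=
      fun n => (p.stepTo_getVert n).mono (G.within_le H)
    have hmem : ∀ n, p.getVert n ∈ H := by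
      intro n
      induction n with
      | zero => simpa using hu
      | succ n ih =>
        obtain h | h := p.stepTo_getVert n
        · exact h ▸ ih
        · exact h.2.2
    have hdp : ∀ n < D, (G.within H).dist u (p.getVert n) = n := by
      intro n hn
      have h1 := SimpleGraph.dist_le (p.take n)
      obtain ⟨q, hq⟩ := (p.take n).reachable.exists_walk_length_eq_dist
      have h2 := SimpleGraph.dist_le (q.append (p.drop n))
      rw [SimpleGraph.Walk.length_append, SimpleGraph.Walk.drop_length] at h2
      rw [SimpleGraph.Walk.take_length] at h1
      omega
    refine key p.getVert (fun r => (G.within H).dist u r) ((range D).image p.getVert) hγ hφ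
      (fun x hx => ?_) ?_ ?_
    · obtain ⟨n, _, rfl⟩ := mem_image.1 hx
      exact hmem n
    · rw [card_image_of_injOn, card_range]
      intro a ha b hb hab
      rw [← hdp a (by simpa using ha), ← hdp b (by simpa using hb), hab]
    · intro r hr r' hr' hs
      obtain ⟨n, hn, rfl⟩ := mem_image.1 hr'
      have h1 := hφ r hr _ (hmem n) hs
      have h2 := hφ _ (hmem n) r hr hs.symm
      rw [hdp n (by simpa using hn)] at h1 h2
      obtain h | h | h : (G.within H).dist u r + 1 = n ∨ (G.within H).dist u r = n ∨
        (G.within H).dist u r = n + 1 := by omega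
      · rw [← h]; exact hγ _
      · rw [h]; exact .refl _
      · rw [h]; exact (hγ _).symm

end Territory

section Covering

variable {V : Type*}

open Classical in
/-- A family of `s` points, repetitions allowed, such that every set `B S` with `#S` much smaller
than `#(B S)` contains at least `#S` of them. -/
theorem exists_covering_family {H : Finset V} (hH : H.Nonempty) {B : Finset V → Finset V}
    (hB : ∀ S ⊆ H, B S ⊆ H) {κ s : ℕ} (hs : 2 * #H * Real.log (4 * #H) ≤ κ * s) :
    ∃ f : Fin s → V, (∀ j, f j ∈ H) ∧
      ∀ S ⊆ H, S.Nonempty → κ * #S ≤ #(B S) → #S ≤ #{j | f j ∈ B S} := by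
  set m : ℝ := (#H : ℝ) with hm
  have hm1 : 1 ≤ m := by
    rw [hm]; exact_mod_cast hH.card_pos
  set Q : Finset (Finset V) := {S ∈ H.powerset | S.Nonempty ∧ κ * #S ≤ #(B S)} with hQ
  set w : Finset V → V → ℝ := fun S v => if v ∈ B S then 1 / 2 else 1 with hw
  -- the expected total weight of the sets that receive too few points
  have hterm : ∀ S ∈ Q, (2 : ℝ) ^ #S * ∑ f ∈ Fintype.piFinset (fun _ : Fin s => H), ∏ j, w S (f j)
      ≤ m ^ s * (1 / (2 * m)) ^ #S := by
    intro S hS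
    obtain ⟨hSH, hSne, hSB⟩ := by simpa [hQ] using hS
    have h1 : ∑ v ∈ H, w S v = m - #(B S) / 2 := by
      have h2 : ∀ v, w S v = 1 - if v ∈ B S then 1 / 2 else 0 := by
        intro v
        simp only [hw]
        split_ifs <;> norm_num
      simp only [h2, sum_sub_distrib, ← sum_filter, sum_const, filter_mem_eq_inter,
        inter_eq_right.2 (hB S hSH), nsmul_eq_mul, mul_one]
      ring
    have h3 : m - #(B S) / 2 ≤ m * Real.exp (-(#(B S) / (2 * m))) := by
      have := Real.add_one_le_exp (-(#(B S) / (2 * m)))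
      calc m - #(B S) / 2 = m * (-(#(B S) / (2 * m)) + 1) := by field_simp; ring
        _ ≤ _ := by gcongr
    have h4 : (0 : ℝ) ≤ m - #(B S) / 2 := by
      have : (#(B S) : ℝ) ≤ m := by
        rw [hm]; exact_mod_cast card_le_card (hB S hSH)
      have : (0 : ℝ) ≤ #(B S) := by positivity
      linarith
    have h5 : Real.exp (-(#(B S) / (2 * m))) ^ s ≤ (1 / (4 * m)) ^ #S := by
      rw [← Real.exp_nat_mul, ← Real.exp_log (show 0 < 1 / (4 * m) by positivity),
        ← Real.exp_nat_mul, Real.exp_le_exp, one_div, Real.log_inv]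
      have h6 : (κ : ℝ) * #S ≤ #(B S) := by exact_mod_cast hSB
      have h7 : #S * Real.log (4 * m) ≤ s * (#(B S) / (2 * m)) := by
        rw [← mul_div_assoc, le_div_iff₀ (by positivity)]
        calc #S * Real.log (4 * m) * (2 * m) = #S * (2 * m * Real.log (4 * m)) := by ring
          _ ≤ #S * (κ * s) := by gcongr
          _ = s * (κ * #S) := by ring
          _ ≤ _ := by gcongr
      linarith
    rw [← Finset.prod_univ_sum, prod_const, card_univ, Fintype.card_fin, h1]
    calc (2 : ℝ) ^ #S * (m - #(B S) / 2) ^ s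
        ≤ 2 ^ #S * (m * Real.exp (-(#(B S) / (2 * m)))) ^ s := by gcongr
      _ ≤ 2 ^ #S * (m ^ s * (1 / (4 * m)) ^ #S) := by rw [mul_pow]; gcongr
      _ = m ^ s * (2 * (1 / (4 * m))) ^ #S := by rw [mul_pow]; ring
      _ = _ := by congr 2; field_simp; norm_num
  have htotal : ∑ S ∈ Q, (1 / (2 * m)) ^ #S < 1 := by
    have h1 : ∑ S ∈ H.powerset, (1 / (2 * m)) ^ #S = (1 / (2 * m) + 1) ^ #H := by
      simpa using Finset.sum_pow_mul_eq_add_pow (1 / (2 * m)) 1 H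
    have h2 : (1 / (2 * m) + 1) ^ #H < 2 := by
      calc (1 / (2 * m) + 1) ^ #H ≤ Real.exp (1 / (2 * m)) ^ #H := by
            gcongr; exact Real.add_one_le_exp _
        _ = Real.exp (1 / 2) := by
            rw [← Real.exp_nat_mul, ← hm]; congr 1; field_simp
        _ < 2 := by
            rw [← Real.lt_log_iff_exp_lt (by norm_num)]
            linarith [Real.log_two_gt_d9]
    have h3 : ∑ S ∈ insert ∅ Q, (1 / (2 * m)) ^ #S ≤ ∑ S ∈ H.powerset, (1 / (2 * m)) ^ #S := by
      refine sum_le_sum_of_subset_of_nonneg ?_ (fun _ _ _ => by positivity)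
      exact insert_subset (by simp) (filter_subset _ _)
    rw [sum_insert (by simp [hQ])] at h3
    simp only [card_empty, pow_zero] at h3
    linarith
  obtain ⟨f, hf, hlt⟩ : ∃ f ∈ Fintype.piFinset (fun _ : Fin s => H),
      ∑ S ∈ Q, (2 : ℝ) ^ #S * ∏ j, w S (f j) < 1 := by
    refine exists_lt_of_sum_lt ?_
    rw [sum_comm]
    simp only [← mul_sum]
    calc _ ≤ ∑ S ∈ Q, m ^ s * (1 / (2 * m)) ^ #S := sum_le_sum hterm
      _ < m ^ s := by
        rw [← mul_sum]
        exact mul_lt_of_lt_one_right (by positivity) htotal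
      _ = _ := by simp [hm]
  refine ⟨f, by simpa using hf, fun S hSH hSne hSB => ?_⟩
  have hSQ : S ∈ Q := by simp [hQ, hSH, hSne, hSB]
  have hS := (single_le_sum (f := fun S => (2 : ℝ) ^ #S * ∏ j, w S (f j))
    (fun S _ => mul_nonneg (by positivity) (prod_nonneg fun j _ => by
      simp only [hw]; split_ifs <;> norm_num)) hSQ).trans_lt hlt
  have hprod : ∏ j, w S (f j) = (1 / 2) ^ #{j | f j ∈ B S} := by
    simp only [hw]
    rw [prod_ite]
    simp
  simp only [hprod, one_div, inv_pow] at hS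
  rw [← div_eq_mul_inv, div_lt_one (by positivity)] at hS
  exact ((pow_lt_pow_iff_right₀ (by norm_num)).1 hS).le

end Covering

section Endgame

variable {V : Type*} {G : SimpleGraph V} {c : ℕ} {H : Finset V}

open Classical in
/-- The vertices of `H` at distance at most `R` from `S` inside `H`. -/
noncomputable def SimpleGraph.nbhd (G : SimpleGraph V) (H : Finset V) (R : ℕ) (S : Finset V) :
    Finset V :=
  {v ∈ H | ∃ u ∈ S, (G.within H).dist u v ≤ R}

theorem SimpleGraph.mem_nbhd {R : ℕ} {S : Finset V} {v : V} :
    v ∈ G.nbhd H R S ↔ v ∈ H ∧ ∃ u ∈ S, (G.within H).dist u v ≤ R := by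
  simp [SimpleGraph.nbhd]

theorem SimpleGraph.nbhd_subset (R : ℕ) (S : Finset V) : G.nbhd H R S ⊆ H :=
  fun _ hv => (mem_nbhd.1 hv).1

theorem Linked.stepTo_of_dist_le_one (hH : Linked G H) {u v : V} (hu : u ∈ H) (hv : v ∈ H)
    (h : (G.within H).dist u v ≤ 1) : StepTo G u v := by
  obtain h | h := Nat.le_one_iff_eq_zero_or_eq_one.1 h
  · exact Or.inl ((hH u hu v hv).dist_eq_zero_iff.1 h).symm
  · exact Or.inr (SimpleGraph.dist_eq_one_iff_adj.1 h).1

open Classical in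
/-- Cops can be placed so that, from any set `U`, all but a subset `A` of small expansion can be
occupied simultaneously within `R` moves. -/
theorem Linked.exists_placement (hH : Linked G H) (hne : H.Nonempty) {κ s : ℕ}
    (hs : 2 * #H * Real.log (4 * #H) ≤ κ * s) (R : ℕ) :
    ∃ f : Fin s → V, ∀ U ⊆ H, ∃ A ⊆ U, #(G.nbhd H R A) ≤ κ * #A ∧ ∃ y : ℕ → Fin s → V,
      y 0 = f ∧ (∀ n j, StepTo G (y n j) (y (n + 1) j)) ∧ ∀ u ∈ U \ A, ∃ j, y R j = u := by
  obtain ⟨f, hfH, hf⟩ := exists_covering_family hne (B := G.nbhd H R)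
    (fun S _ => G.nbhd_subset R S) hs
  refine ⟨f, fun U hU => ?_⟩
  obtain ⟨A, hA, hmax⟩ := exists_max_image {A ∈ U.powerset | #(G.nbhd H R A) ≤ κ * #A} card
    ⟨∅, mem_filter.2 ⟨empty_mem_powerset _, by simp [SimpleGraph.nbhd]⟩⟩
  obtain ⟨hAU, hAκ⟩ : A ⊆ U ∧ #(G.nbhd H R A) ≤ κ * #A := by simpa using hA
  refine ⟨A, hAU, hAκ, ?_⟩
  have hexp : ∀ S ⊆ U \ A, S.Nonempty → κ * #S ≤ #(G.nbhd H R S) := by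
    intro S hS hSne
    by_contra! hlt
    have hdisj : Disjoint A S := disjoint_of_subset_right hS disjoint_sdiff
    have hsub : G.nbhd H R (A ∪ S) ⊆ G.nbhd H R A ∪ G.nbhd H R S := by
      intro v hv
      obtain ⟨hvH, u, hu, hd⟩ := SimpleGraph.mem_nbhd.1 hv
      obtain hu | hu := mem_union.1 hu
      · exact mem_union_left _ (SimpleGraph.mem_nbhd.2 ⟨hvH, u, hu, hd⟩)
      · exact mem_union_right _ (SimpleGraph.mem_nbhd.2 ⟨hvH, u, hu, hd⟩)
    have hcard := card_union_of_disjoint hdisj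
    have h1 : #(G.nbhd H R (A ∪ S)) ≤ κ * #(A ∪ S) := by
      rw [hcard, mul_add]
      exact (card_le_card hsub).trans ((card_union_le _ _).trans (add_le_add hAκ hlt.le))
    have h2 := hmax (A ∪ S) (by simp [h1, hAU, hS.trans sdiff_subset, union_subset])
    have := hSne.card_pos
    omega
  have hhall := (Finset.all_card_le_biUnion_card_iff_exists_injective
    (fun u : ↥(U \ A) => ({j | f j ∈ G.nbhd H R {u.1}} : Finset (Fin s)))).1 (by
      intro S
      obtain rfl | hne := S.eq_empty_or_nonempty
      · simp
      have hSU : S.map (Function.Embedding.subtype _) ⊆ U \ A := by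
        intro x hx
        obtain ⟨y, _, rfl⟩ := mem_map.1 hx
        exact y.2
      have h1 := hf _ (hSU.trans (sdiff_subset.trans hU)) (by simpa using hne)
        (hexp _ hSU (by simpa using hne))
      rw [card_map] at h1
      refine h1.trans (card_le_card fun j hj => ?_)
      obtain ⟨hjH, u, hu, hd⟩ := SimpleGraph.mem_nbhd.1 (mem_filter.1 hj).2
      obtain ⟨x, hx, rfl⟩ := mem_map.1 hu
      exact mem_biUnion.2 ⟨x, hx, by simpa [SimpleGraph.mem_nbhd] using ⟨hjH, hd⟩⟩)
  obtain ⟨τ, hτ, hτmem⟩ := hhall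
  have hwalk : ∀ j, ∃ y : ℕ → V, y 0 = f j ∧ (∀ n, StepTo G (y n) (y (n + 1))) ∧
      ∀ u, τ u = j → y R = u := by
    intro j
    by_cases hj : ∃ u, τ u = j
    · obtain ⟨u, rfl⟩ := hj
      obtain ⟨hjH, hd⟩ := by simpa [SimpleGraph.mem_nbhd] using hτmem u
      obtain ⟨p, hp⟩ := (hH _ hjH _ (hU (mem_sdiff.1 u.2).1)).exists_walk_length_eq_dist
      refine ⟨p.getVert, by simp, fun n => (p.stepTo_getVert n).mono (G.within_le H), ?_⟩
      intro u' hu'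
      obtain rfl := hτ hu'
      exact p.getVert_of_length_le (by rw [hp, SimpleGraph.dist_comm]; exact hd)
    · exact ⟨fun _ => f j, rfl, fun _ => .refl _, fun u hu => absurd ⟨u, hu⟩ hj⟩
  choose y hy0 hystep hyR using hwalk
  exact ⟨fun n j => y j n, funext hy0, fun n j => hystep j n,
    fun u hu => ⟨τ ⟨u, hu⟩, hyR _ ⟨u, hu⟩ rfl⟩⟩

variable {K : Finset (Fin c)} {σ : Fin c → V → V}

theorem Linked.exists_evader_dist_le (hH : Linked G H) {X : ℕ → Fin c → V} {v : V} (hv : v ∈ H)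
    (m k : ℕ) {r' : V} (hr' : r' ∈ evaders G H K X v (m + k)) :
    ∃ r ∈ evaders G H K X v m, (G.within H).dist r r' ≤ k := by
  induction k generalizing r' with
  | zero => exact ⟨r', hr', by simp⟩
  | succ k ih =>
    obtain ⟨hr'H, ⟨x, hx, hxr'⟩, -⟩ := hr'
    obtain ⟨r, hr, hd⟩ := ih hx
    refine ⟨r, hr, ?_⟩
    have := hH.dist_le_dist_add_one (evaders_subset hv _ _ hr) (evaders_subset hv _ _ hx) hr'H hxr'
    omega

/-- With enough free cops to occupy the whole territory, the robber loses. -/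
theorem Guarding.robberLoses_of_card_le (hG : Guarding G H K σ) (hconn : G.Connected)
    (hc : #H ≤ #Kᶜ) {C : Fin c → V} {r : V} (hp : InPosition H K σ C r) :
    RobberLoses G C r := by
  obtain ⟨g⟩ : Nonempty (H ↪ ↥Kᶜ) :=
    Function.Embedding.nonempty_of_card_le (by simpa only [Fintype.card_coe] using hc)
  have hg : Function.Injective fun x => (g x : Fin c) := Subtype.val_injective.comp g.injective
  refine hG.robberLoses_of_reposition hconn
    (Function.extend (fun x => (g x : Fin c)) (fun x => (x : V)) C)
    (fun C' r' hp' hC' x hx => ?_) hp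
  have h := hC' (g ⟨r', hp'.1⟩) (mem_compl.1 (g _).2)
  rw [hg.extend_apply] at h
  exact CopsWin.of_stepTo (g ⟨r', hp'.1⟩) (h ▸ hx)

open Classical in
/-- The cops win on a territory of small diameter and small degrees: the group of cops numbered
`i` covers, at time `2 ^ i`, all possible positions of the robber outside a set of small
expansion. -/
theorem Guarding.robberLoses_of_dist_lt (hG : Guarding G H K σ) (hconn : G.Connected)
    (hH : Linked G H) {t κ s : ℕ} (hdist : ∀ v ∈ H, ∀ w ∈ H, (G.within H).dist v w < 2 ^ t)
    (hdeg : ∀ v ∈ H, #{w ∈ H | StepTo G v w} < 2 ^ t)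
    (hs : 2 * #H * Real.log (4 * #H) ≤ κ * s)
    (hc : κ ^ (t + 1) * 2 ^ t + (t + 1) * s ≤ #Kᶜ) {C : Fin c → V} {r : V}
    (hp : InPosition H K σ C r) : RobberLoses G C r := by
  by_cases hsmall : #H ≤ #Kᶜ
  · exact hG.robberLoses_of_card_le hconn hsmall hp
  have hlarge : κ ^ (t + 1) * 2 ^ t < #H := by omega
  have hne : H.Nonempty := ⟨r, hp.1⟩
  obtain ⟨g⟩ : Nonempty (Fin (t + 1) × Fin s ↪ ↥Kᶜ) :=
    Function.Embedding.nonempty_of_card_le (by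
      simpa only [Fintype.card_prod, Fintype.card_fin, Fintype.card_coe] using le_of_add_le_right hc)
  set e : Fin (t + 1) × Fin s → Fin c := fun q => g q with he
  have heinj : Function.Injective e := Subtype.val_injective.comp g.injective
  have heK : ∀ q, e q ∉ K := fun q => mem_compl.1 (g q).2
  choose f hf using fun i : ℕ => hH.exists_placement hne hs (2 ^ i)
  choose! A hAU hAκ y hy0 hystep hycover using hf
  refine hG.robberLoses_of_reposition hconn
    (Function.extend e (fun q => f q.1 q.2) fun _ => r) (fun C' v hp' hC' => ?_) hp
  have hv := hp'.1
  let U : ℕ → Finset V := fun i =>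
    Nat.rec (G.nbhd H 1 {v}) (fun i U => G.nbhd H (2 ^ i) (A i U)) i
  have hUH : ∀ i, U i ⊆ H := by
    rintro (_ | i) <;> exact G.nbhd_subset _ _
  have hUcard : ∀ i, #(U i) ≤ κ ^ i * 2 ^ t := by
    intro i
    induction i with
    | zero =>
      rw [pow_zero, one_mul]
      refine le_trans (card_le_card fun w hw => ?_) (hdeg v hv).le
      obtain ⟨hwH, u, hu, hd⟩ := SimpleGraph.mem_nbhd.1 hw
      obtain rfl := mem_singleton.1 hu
      exact mem_filter.2 ⟨hwH, hH.stepTo_of_dist_le_one hv hwH hd⟩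
    | succ i ih =>
      calc #(U (i + 1)) ≤ κ * #(A i (U i)) := hAκ i _ (hUH i)
        _ ≤ κ * (κ ^ i * 2 ^ t) := by
          gcongr
          exact (card_le_card (hAU i _ (hUH i))).trans ih
        _ = _ := by ring
  set X : ℕ → Fin c → V := fun n =>
    Function.extend e (fun q => y q.1 (U q.1) (hUH _) n q.2) fun _ => r with hX
  refine hG.robberLoses_of_schedule (X := X) (fun n i _ => ?_) (2 ^ t) (fun _ r' hr' _ _ => ?_)
    hp' (fun i hi => ?_)
  · by_cases hi : ∃ q, e q = i
    · obtain ⟨q, rfl⟩ := hi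
      simpa [hX, heinj.extend_apply] using hystep q.1 _ (hUH _) n q.2
    · simpa [hX, Function.extend_apply' _ _ _ hi] using .refl r
  · have hcov : ∀ i ≤ t, ∀ x ∈ evaders G H K X v (2 ^ i), x ∈ U i → x ∈ A i (U i) := by
      intro i hi x hx hxU
      by_contra hxA
      obtain ⟨j, hj⟩ := hycover i _ (hUH i) x (mem_sdiff.2 ⟨hxU, hxA⟩)
      obtain ⟨n, hn⟩ := Nat.exists_eq_add_one.2 (Nat.two_pow_pos i)
      rw [hn] at hx
      refine hx.2.2 (e (⟨i, by omega⟩, j)) (heK _) ?_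
      rw [← hn, hX]
      exact (heinj.extend_apply _ _ _).trans hj
    have key : ∀ i ≤ t, ∀ x ∈ evaders G H K X v (2 ^ i), x ∈ A i (U i) := by
      intro i
      induction i with
      | zero =>
        intro hi x hx
        obtain ⟨u, hu, hd⟩ := hH.exists_evader_dist_le hv 0 1 hx
        exact hcov 0 hi x hx
          (SimpleGraph.mem_nbhd.2 ⟨evaders_subset hv _ _ hx, v, mem_singleton_self v, hu ▸ hd⟩)
      | succ i ih =>
        intro hi x hx
        have hx' := hx
        rw [pow_succ, mul_two] at hx'
        obtain ⟨u, hu, hd⟩ := hH.exists_evader_dist_le hv (2 ^ i) (2 ^ i) hx'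
        exact hcov (i + 1) hi x hx
          (SimpleGraph.mem_nbhd.2 ⟨evaders_subset hv _ _ hx, u, ih (by omega) u hu, hd⟩)
    have hr'A := key t le_rfl r' hr'
    have hall : H ⊆ G.nbhd H (2 ^ t) (A t (U t)) := fun x hx => SimpleGraph.mem_nbhd.2
      ⟨hx, r', hr'A, (hdist _ (hUH t (hAU t _ (hUH t) hr'A)) _ hx).le⟩
    have := (card_le_card hall).trans (hUcard (t + 1))
    omega
  · rw [hC' i hi, hX]
    simp only [hy0]

end Endgame

theorem linked_univ {V : Type*} [Fintype V] {G : SimpleGraph V} (hconn : G.Connected) :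
    Linked G univ := by
  have : G.within univ = G := by
    ext a b
    simp [SimpleGraph.within]
  intro u _ v _
  rw [this]
  exact hconn u v

theorem copNumber_le {V : Type*} [Fintype V] {G : SimpleGraph V} (hconn : G.Connected)
    {t κ s : ℕ}
    (hs : 2 * Fintype.card V * Real.log (4 * Fintype.card V) ≤ κ * s) :
    copNumber G ≤ Fintype.card V / 2 ^ t + (κ ^ (t + 1) * 2 ^ t + (t + 1) * s) := by
  obtain ⟨v⟩ := hconn.nonempty
  refine Nat.sInf_le ⟨fun _ => v, fun r => ?_⟩
  have hG : Guarding G univ (∅ : Finset (Fin (Fintype.card V / 2 ^ t +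
      (κ ^ (t + 1) * 2 ^ t + (t + 1) * s)))) (fun _ => id) := ⟨by simp, by simp⟩
  refine hG.robberLoses_of_endgame (M := κ ^ (t + 1) * 2 ^ t + (t + 1) * s) hconn
    (Nat.two_pow_pos t) ?_ (linked_univ hconn) (by simp) ⟨mem_univ r, by simp⟩ r (.refl r)
  intro H K σ hG hH hdist hdeg hc C r hp
  refine hG.robberLoses_of_dist_lt hconn hH hdist hdeg (le_trans ?_ hs) hc hp
  have h1 : (1 : ℝ) ≤ #H := by exact_mod_cast card_pos.2 ⟨r, hp.1⟩
  have h2 : (#H : ℝ) ≤ Fintype.card V := by exact_mod_cast card_le_univ H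
  have h3 : 0 ≤ Real.log (4 * #H) := Real.log_nonneg (by linarith)
  gcongr

/-- The growth conditions on `x = √(log₂ n)` used in the final estimate. -/
theorem eventually_growth {ε : ℝ} (hε : 0 < ε) : ∀ᶠ x : ℝ in Filter.atTop,
    3 ≤ x ∧ 5 * x + 5 ≤ ε / 2 * x ^ 2 ∧ 8 * (x + 2) * (x ^ 2 + 2) ≤ 2 ^ (ε / 2 * x) := by
  have hlog := Real.log_pos one_lt_two
  have h := (isLittleO_pow_exp_pos_mul_atTop 3 (show 0 < Real.log 2 * (ε / 2) by positivity)).bound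
    (show (0 : ℝ) < 1 / 32 by norm_num)
  filter_upwards [h, Filter.eventually_ge_atTop 3, Filter.eventually_ge_atTop (20 / ε)]
    with x h hx3 hxε
  rw [div_le_iff₀ hε] at hxε
  refine ⟨hx3, by nlinarith, ?_⟩
  rw [Real.norm_of_nonneg (by positivity), Real.norm_of_nonneg (by positivity)] at h
  rw [Real.rpow_def_of_pos two_pos, ← mul_assoc]
  nlinarith [mul_nonneg (sub_nonneg.2 hx3) (sq_nonneg x)]

theorem eventually_le_div_two_rpow {ε : ℝ} (hε : 0 < ε) (hε1 : ε ≤ 1) :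
    ∀ᶠ n : ℕ in Filter.atTop, ∃ t κ s : ℕ, 2 * n * Real.log (4 * n) ≤ κ * s ∧
      ((n / 2 ^ t + (κ ^ (t + 1) * 2 ^ t + (t + 1) * s) : ℕ) : ℝ) ≤
        n / 2 ^ ((1 - ε) * Real.sqrt (Real.logb 2 n)) := by
  have hx : Filter.Tendsto (fun n : ℕ => Real.sqrt (Real.logb 2 n)) Filter.atTop Filter.atTop :=
    Real.tendsto_sqrt_atTop.comp
      ((Real.tendsto_logb_atTop one_lt_two).comp tendsto_natCast_atTop_atTop)
  filter_upwards [hx.eventually (eventually_growth hε), Filter.eventually_ge_atTop 1]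
    with n ⟨hx3, hx5, hx8⟩ hn
  have hn0 : (0 : ℝ) < n := by exact_mod_cast hn
  set x := Real.sqrt (Real.logb 2 n) with hxdef
  have hlogb : Real.logb 2 n = x ^ 2 := by
    refine (Real.sq_sqrt ?_).symm
    exact Real.logb_nonneg one_lt_two (by exact_mod_cast hn)
  have hnx : (n : ℝ) = 2 ^ (x ^ 2) := by
    rw [← hlogb, Real.rpow_logb two_pos (by norm_num) hn0]
  set g : ℝ := 2 ^ ((1 - ε) * x) with hg
  set h : ℝ := 2 ^ (ε / 2 * x) with hh
  have hg0 : 0 < g := by positivity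
  have hh0 : 0 < h := by positivity
  have hgh : (2 : ℝ) ^ ((1 - ε / 2) * x) = g * h := by
    rw [hg, hh, ← Real.rpow_add two_pos]
    ring_nf
  have hghh : (2 : ℝ) ^ x = g * h * h := by
    rw [← hgh, hh, ← Real.rpow_add two_pos]
    ring_nf
  have hh2 : x + 2 ≤ h := by nlinarith
  have hxt : x ≤ ⌈x⌉₊ := Nat.le_ceil x
  have htx : (⌈x⌉₊ : ℝ) ≤ x + 1 := (Nat.ceil_lt_add_one (by linarith)).le
  set t := ⌈x⌉₊
  have hκ : g * h ≤ ⌈g * h⌉₊ := Nat.le_ceil _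
  have hgh1 : 1 ≤ g * h := hgh ▸ Real.one_le_rpow one_le_two (by nlinarith)
  have hκ' : (⌈g * h⌉₊ : ℝ) ≤ 2 ^ ((1 - ε / 2) * x + 1) := by
    rw [Real.rpow_add_one two_ne_zero, hgh]
    linarith [Nat.ceil_lt_add_one (show 0 ≤ g * h by positivity)]
  set κ := ⌈g * h⌉₊
  have hκ0 : (0 : ℝ) < κ := by linarith
  have hlog4 : Real.log (4 * n) ≤ x ^ 2 + 2 := by
    rw [hnx, Real.log_mul (by norm_num) (by positivity), Real.log_rpow two_pos,
      show (4 : ℝ) = 2 ^ 2 by norm_num, Real.log_pow]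
    have := Real.log_two_lt_d9
    push_cast
    nlinarith [sq_nonneg x]
  have hlog0 : 0 ≤ Real.log (4 * n) := by
    refine Real.log_nonneg ?_
    have : (1 : ℝ) ≤ n := by exact_mod_cast hn
    linarith
  refine ⟨t, κ, ⌈2 * n * Real.log (4 * n) / κ⌉₊, ?_, ?_⟩
  · rw [← div_le_iff₀' hκ0]
    exact Nat.le_ceil _
  have hs := (Nat.ceil_lt_add_one (show 0 ≤ 2 * n * Real.log (4 * n) / κ by positivity)).le
  set s := ⌈2 * n * Real.log (4 * n) / κ⌉₊
  have hquarter : n / g / 4 = 2 ^ (x ^ 2 - (1 - ε) * x - 2) := by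
    rw [Real.rpow_sub two_pos, Real.rpow_sub two_pos, ← hnx, ← hg]
    norm_num
  have e1 : ((n / 2 ^ t : ℕ) : ℝ) ≤ n / g / 4 := by
    calc ((n / 2 ^ t : ℕ) : ℝ) ≤ n / 2 ^ t := by exact_mod_cast Nat.cast_div_le (α := ℝ)
      _ ≤ n / 2 ^ x := by
        rw [← Real.rpow_natCast]
        gcongr
        exact one_le_two
      _ = n / (g * (h * h)) := by rw [hghh, mul_assoc]
      _ ≤ n / (g * 4) := by gcongr; nlinarith
      _ = n / g / 4 := by rw [div_div]
  have e2 : (κ : ℝ) ^ (t + 1) * 2 ^ t ≤ n / g / 4 := by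
    have hκpow : (κ : ℝ) ^ (t + 1) ≤ 2 ^ (((1 - ε / 2) * x + 1) * (x + 2)) := by
      calc (κ : ℝ) ^ (t + 1) ≤ (2 ^ ((1 - ε / 2) * x + 1)) ^ (t + 1) := by gcongr
        _ = 2 ^ (((1 - ε / 2) * x + 1) * (t + 1 : ℕ)) := by
          rw [Real.rpow_mul two_pos.le, Real.rpow_natCast]
        _ ≤ _ := by
          gcongr
          · exact one_le_two
          · nlinarith
          · push_cast; linarith
    have h2pow : (2 : ℝ) ^ t ≤ 2 ^ (x + 1) := by
      rw [← Real.rpow_natCast]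
      gcongr
      exact one_le_two
    calc (κ : ℝ) ^ (t + 1) * 2 ^ t ≤ 2 ^ (((1 - ε / 2) * x + 1) * (x + 2)) * 2 ^ (x + 1) := by
          gcongr
      _ = 2 ^ (((1 - ε / 2) * x + 1) * (x + 2) + (x + 1)) := (Real.rpow_add two_pos _ _).symm
      _ ≤ 2 ^ (x ^ 2 - (1 - ε) * x - 2) := by
        gcongr
        · exact one_le_two
        · nlinarith
      _ = _ := hquarter.symm
  have e3 : (x + 2) * (2 * n * Real.log (4 * n) / κ) ≤ n / g / 4 := by
    calc (x + 2) * (2 * n * Real.log (4 * n) / κ)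
        ≤ (x + 2) * (2 * n * (x ^ 2 + 2) / (g * h)) := by gcongr
      _ = (8 * (x + 2) * (x ^ 2 + 2)) / h * (n / g / 4) := by field_simp; ring
      _ ≤ 1 * (n / g / 4) := by gcongr; exact (div_le_one hh0).2 hx8
      _ = _ := one_mul _
  have e4 : x + 2 ≤ n / g / 4 := by
    rw [hquarter]
    refine hh2.trans ?_
    rw [hh]
    gcongr
    · exact one_le_two
    · linarith [mul_le_mul_of_nonneg_right hx3 (show 0 ≤ x by linarith),
        mul_pos hε (show 0 < x by linarith), sq x]
  have e5 : ((t : ℝ) + 1) * s ≤ (x + 2) * (2 * n * Real.log (4 * n) / κ + 1) :=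
    mul_le_mul (by linarith) hs (Nat.cast_nonneg s) (by linarith)
  have e6 : n / g = 4 * (n / g / 4) := by ring
  push_cast
  linarith

/-- Every connected graph on `n` vertices (for `n` large, depending on `ε`)
has cop number at most `n / 2^((1-ε)·√(log₂ n))`. -/
theorem copNumber_upper_bound :
    ∀ ε : ℝ, 0 < ε → ∃ N : ℕ, ∀ n : ℕ, N ≤ n →
      ∀ (V : Type) [Fintype V], Fintype.card V = n →
        ∀ G : SimpleGraph V, G.Connected →
          (copNumber G : ℝ) ≤ n / 2 ^ ((1 - ε) * Real.sqrt (Real.logb 2 n)) := by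
  intro ε hε
  obtain ⟨N, hN⟩ := Filter.eventually_atTop.1
    (eventually_le_div_two_rpow (lt_min hε one_pos) (min_le_right ε 1))
  refine ⟨N, fun n hn V _ hV G hG => ?_⟩
  obtain ⟨t, κ, s, hs, hle⟩ := hN n hn
  subst hV
  calc (copNumber G : ℝ) ≤ _ := Nat.cast_le.2 (copNumber_le hG hs)
    _ ≤ _ := hle
    _ ≤ _ := by
      gcongr
      · exact one_le_two
      · exact min_le_left ε 1
end

section
/- Let R ≥ 1 be a fixed integer and set α = 1 + 1/R. For every ε > 0 there exists N such that for every connected graph G on n ≥ N vertices, the speed-R cop number satisfies c_R(G) ≤ n / α^{(1-ε)·√(log_α n)}. -/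
/-- A legal move of a speed-`R` robber from `u` to `v`, with the cops at
positions `C`: a walk of at most `R` edges all of whose vertices after the
starting one avoid the cops. -/
def RobberMoveR {V : Type*} (G : SimpleGraph V) {c : ℕ} (C : Fin c → V) (R : ℕ)
    (u v : V) : Prop :=
  ∃ k : ℕ, k ≤ R ∧ ∃ f : ℕ → V, f 0 = u ∧ f k = v ∧
    (∀ i, i < k → G.Adj (f i) (f (i + 1))) ∧
    (∀ i, 0 < i → i ≤ k → ∀ j, C j ≠ f i)

/-- `CopsWinR G R c C r`: with cops at positions `C`, a speed-`R` robber at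
`r`, and the cops to move, the `c` cops can force a capture. -/
inductive CopsWinR {V : Type*} (G : SimpleGraph V) (R : ℕ) (c : ℕ) :
    (Fin c → V) → V → Prop
  | catch (C C' : Fin c → V) (r : V) (hm : CopMove G C C') (i : Fin c)
      (hi : C' i = r) : CopsWinR G R c C r
  | step (C C' : Fin c → V) (r : V) (hm : CopMove G C C')
      (h : ∀ r', RobberMoveR G C' R r r' → CopsWinR G R c C' r') : CopsWinR G R c C r

/-- The speed-`R` cop number: the least number of cops having a winning
strategy against a robber of speed `R`. -/
noncomputable def copNumberR {V : Type*} (G : SimpleGraph V) (R : ℕ) : ℕ :=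
  sInf {c : ℕ | ∃ C₀ : Fin c → V, ∀ r : V, CopsWinR G R c C₀ r}


open Finset

section LazyWalks

/-- A walk parametrised by `ℕ` that may pause at each step. -/
def IsLazyWalk {V : Type*} (G : SimpleGraph V) (f : ℕ → V) : Prop :=
  ∀ t, f (t + 1) = f t ∨ G.Adj (f t) (f (t + 1))

variable {V : Type*} {G : SimpleGraph V}

lemma IsLazyWalk.comp_min {f : ℕ → V} (hf : IsLazyWalk G f) (N : ℕ) :
    IsLazyWalk G fun t => f (min t N) := by
  intro t
  rcases lt_or_ge t N with h | h
  · simpa [min_eq_left h.le, min_eq_left (Nat.succ_le_of_lt h)] using hf t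
  · left
    simp [min_eq_right h, min_eq_right (h.trans (Nat.le_succ t))]

lemma IsLazyWalk.const (v : V) : IsLazyWalk G fun _ => v := fun _ => Or.inl rfl

lemma SimpleGraph.Walk.isLazyWalk_getVert {u v : V} (w : G.Walk u v) :
    IsLazyWalk G w.getVert := by
  intro t
  rcases lt_or_ge t w.length with h | h
  · exact Or.inr (w.adj_getVert_succ h)
  · left
    rw [w.getVert_of_length_le h, w.getVert_of_length_le (h.trans (Nat.le_succ t))]

end LazyWalks

section ObliviousStrategies

variable {V : Type*} {G : SimpleGraph V} {R c : ℕ}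

/-- A lazy walk at speed `R` (the `T`-th round consists of the steps from `(T - 1) * R` to `T * R`)
that avoids the cops moving along `C` during the first `N` rounds. -/
def Evades (R : ℕ) (C : ℕ → Fin c → V) (N : ℕ) (g : ℕ → V) : Prop :=
  ∀ T < N, ∀ j ≤ R, ∀ i, C (T + 1) i ≠ g (T * R + j)

/-- Cops following a trajectory fixed in advance win if they win against every robber that
evaded them for `N` rounds. -/
lemma copsWinR_of_evades {C : ℕ → Fin c → V} (hC : ∀ T, CopMove G (C T) (C (T + 1)))
    {v : V} {N : ℕ}
    (hN : ∀ g, IsLazyWalk G g → g 0 = v → Evades R C N g → CopsWinR G R c (C N) (g (N * R))) :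
    CopsWinR G R c (C 0) v := by
  have key : ∀ d T, T + d = N → ∀ g, IsLazyWalk G g → g 0 = v → Evades R C T g →
      CopsWinR G R c (C T) (g (T * R)) := by
    intro d
    induction d with
    | zero =>
      rintro T rfl
      exact hN
    | succ d ih =>
      intro T hT g hg hg0 hev
      by_cases hocc : ∃ i, C (T + 1) i = g (T * R)
      · obtain ⟨i, hi⟩ := hocc
        exact CopsWinR.catch _ _ _ (hC T) i hi
      · push Not at hocc
        refine CopsWinR.step _ _ _ (hC T) ?_
        rintro r' ⟨k, hk, f, hf0, hfk, hadj, havoid⟩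
        have hav : ∀ t i, C (T + 1) i ≠ f (min t k) := by
          intro t i
          rcases Nat.eq_zero_or_pos (min t k) with h | h
          · rw [h, hf0]
            exact hocc i
          · exact havoid _ h (min_le_right _ _) i
        set g' : ℕ → V := fun t => if t ≤ T * R then g t else f (min (t - T * R) k) with hg'
        have hge : ∀ j, g' (T * R + j) = f (min j k) := by
          intro j
          rcases Nat.eq_zero_or_pos j with rfl | h
          · simp [hg', hf0]
          · have : ¬ T * R + j ≤ T * R := by omega
            simp [hg', this]
        have hle : ∀ t ≤ T * R, g' t = g t := fun t ht => by simp [hg', ht]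
        have h1 := ih (T + 1) (by omega) g' ?_ (by rw [hle 0 (Nat.zero_le _), hg0]) ?_
        · rwa [add_mul, one_mul, hge, min_eq_right hk, hfk] at h1
        · intro t
          rcases lt_or_ge t (T * R) with h | h
          · rw [hle t h.le, hle (t + 1) h]
            exact hg t
          · obtain ⟨j, rfl⟩ := Nat.exists_eq_add_of_le h
            rw [add_assoc, hge, hge]
            rcases lt_or_ge j k with h' | h'
            · rw [min_eq_left h'.le, min_eq_left (Nat.succ_le_of_lt h')]
              exact Or.inr (hadj j h')
            · left
              rw [min_eq_right h', min_eq_right (h'.trans (Nat.le_succ j))]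
        · intro S hS j hj i
          rcases Nat.lt_succ_iff_lt_or_eq.mp hS with h | rfl
          · rw [hle]
            · exact hev S h j hj i
            · calc S * R + j ≤ (S + 1) * R := by rw [add_mul, one_mul]; omega
                _ ≤ T * R := Nat.mul_le_mul_right _ h
          · rw [hge]
            exact hav j i
  have h0 := fun g hg hg0 => key N 0 (Nat.zero_add N) g hg hg0 (by intro T hT; omega)
  simpa using h0 (fun _ => v) (IsLazyWalk.const v) rfl

/-- A robber starting inside a set whose outer boundary is guarded stays inside it. -/
lemma Evades.mem_of_guarded {C : ℕ → Fin c → V} {N : ℕ} {g : ℕ → V} (hR : 1 ≤ R)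
    (hg : IsLazyWalk G g) (hev : Evades R C N g) {U : Finset V} (h0 : g 0 ∈ U)
    (hguard : ∀ u ∈ U, ∀ w ∉ U, G.Adj u w → ∀ T, ∃ i, C T i = w) :
    ∀ t ≤ N * R, g t ∈ U := by
  intro t
  induction t with
  | zero => exact fun _ => h0
  | succ t ih =>
    intro ht
    have hmem := ih (by omega)
    rcases hg t with h | h
    · rwa [h]
    · by_contra hout
      obtain ⟨i, hi⟩ := hguard _ hmem _ hout h (t / R + 1)
      have h1 : t % R < R := Nat.mod_lt _ hR
      have h2 : t / R * R + t % R = t := Nat.div_add_mod' t R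
      refine hev (t / R) ?_ (t % R + 1) h1 i ?_
      · exact Nat.div_lt_of_lt_mul (by rw [mul_comm]; omega)
      · rw [hi, ← add_assoc, h2]

/-- In a connected graph the cops may move to any other configuration, while the cops that need
not move keep the robber inside a guarded set. -/
lemma copsWinR_of_reposition [Finite V] (hG : G.Connected) (hR : 1 ≤ R) {C C' : Fin c → V}
    {U : Finset V}
    (hguard : ∀ u ∈ U, ∀ w ∉ U, G.Adj u w → ∃ i, C i = w ∧ C' i = w)
    (hwin : ∀ r ∈ U, CopsWinR G R c C' r) {r : V} (hr : r ∈ U) : CopsWinR G R c C r := by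
  classical
  have hw : ∀ i, ∃ f : ℕ → V, IsLazyWalk G f ∧ f 0 = C i ∧ (∃ n, ∀ t ≥ n, f t = C' i) ∧
      (C i = C' i → ∀ t, f t = C i) := by
    intro i
    by_cases h : C i = C' i
    · exact ⟨fun _ => C i, IsLazyWalk.const _, rfl, ⟨0, fun _ _ => h⟩, fun _ _ => rfl⟩
    · obtain ⟨w⟩ := hG.preconnected (C i) (C' i)
      exact ⟨w.getVert, w.isLazyWalk_getVert, by simp,
        ⟨w.length, fun t ht => w.getVert_of_length_le ht⟩, fun h' => absurd h' h⟩
  choose f hlazy hf0 hfn hstay using hw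
  choose n hn using hfn
  have hN : ∀ i, f i (univ.sup n) = C' i := fun i => hn i _ (le_sup (f := n) (mem_univ i))
  have := copsWinR_of_evades (G := G) (R := R) (C := fun T i => f i T) (v := r)
    (N := univ.sup n) (fun T i => hlazy i T) ?_
  · simpa only [hf0] using this
  · intro g hg hg0 hev
    simp only [hN]
    refine hwin _ (hev.mem_of_guarded hR hg (by rwa [hg0]) ?_ _ le_rfl)
    intro u hu w hw huw T
    obtain ⟨i, hi, hi'⟩ := hguard u hu w hw huw
    exact ⟨i, by rw [hstay i (hi.trans hi'.symm), hi]⟩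

end ObliviousStrategies

section Balls

variable {W : Type*} [Fintype W]

open Classical in
/-- The vertices at distance at most one from `S`. -/
noncomputable def closedNbhd (H : SimpleGraph W) (S : Finset W) : Finset W :=
  univ.filter fun w => ∃ u ∈ S, w = u ∨ H.Adj u w

/-- The vertices at distance at most `r` from `S`. -/
noncomputable def nball (H : SimpleGraph W) (r : ℕ) (S : Finset W) : Finset W :=
  (closedNbhd H)^[r] S

variable {H : SimpleGraph W}

lemma mem_closedNbhd {S : Finset W} {w : W} :
    w ∈ closedNbhd H S ↔ ∃ u ∈ S, w = u ∨ H.Adj u w := by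
  simp [closedNbhd]

lemma subset_closedNbhd (S : Finset W) : S ⊆ closedNbhd H S :=
  fun w hw => mem_closedNbhd.2 ⟨w, hw, Or.inl rfl⟩

lemma nball_succ (r : ℕ) (S : Finset W) :
    nball H (r + 1) S = closedNbhd H (nball H r S) :=
  Function.iterate_succ_apply' _ _ _

lemma subset_nball (r : ℕ) (S : Finset W) : S ⊆ nball H r S := by
  induction r with
  | zero => exact Subset.rfl
  | succ r ih => rw [nball_succ]; exact ih.trans (subset_closedNbhd _)

lemma mem_nball_iff_singleton {r : ℕ} {S : Finset W} {w : W} :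
    w ∈ nball H r S ↔ ∃ u ∈ S, w ∈ nball H r {u} := by
  induction r generalizing w with
  | zero => simp [nball]
  | succ r ih =>
    simp only [nball_succ, mem_closedNbhd]
    constructor
    · rintro ⟨x, hx, hxw⟩
      obtain ⟨u, hu, hux⟩ := ih.1 hx
      exact ⟨u, hu, x, hux, hxw⟩
    · rintro ⟨u, hu, x, hux, hxw⟩
      exact ⟨x, ih.2 ⟨u, hu, hux⟩, hxw⟩

lemma exists_isLazyWalk_of_mem_nball {r : ℕ} {u w : W} (h : w ∈ nball H r {u}) :
    ∃ f : ℕ → W, IsLazyWalk H f ∧ f 0 = w ∧ ∀ t ≥ r, f t = u := by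
  induction r generalizing w with
  | zero =>
    have hw : w = u := by simpa [nball] using h
    exact ⟨fun _ => u, IsLazyWalk.const u, hw.symm, fun _ _ => rfl⟩
  | succ r ih =>
    rw [nball_succ, mem_closedNbhd] at h
    obtain ⟨x, hx, hxw⟩ := h
    obtain ⟨f, hf, hf0, hfr⟩ := ih hx
    refine ⟨fun t => Nat.casesOn t w f, ?_, rfl, ?_⟩
    · rintro (_ | t)
      · change f 0 = w ∨ H.Adj w (f 0)
        rw [hf0]
        exact hxw.imp Eq.symm SimpleGraph.Adj.symm
      · exact hf t
    · rintro (_ | t) ht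
      · omega
      · exact hfr t (by omega)

lemma IsLazyWalk.mem_nball {f : ℕ → W} (hf : IsLazyWalk H f) {S : Finset W} {a : ℕ}
    (ha : f a ∈ S) (b : ℕ) : f (a + b) ∈ nball H b S := by
  induction b with
  | zero => exact ha
  | succ b ih =>
    rw [nball_succ, mem_closedNbhd]
    exact ⟨_, ih, hf (a + b)⟩

open Classical in
lemma pow_le_card_nball {p : ℝ} (hp : 0 < p)
    (hexp : ∀ S : Finset W, 2 * #S ≤ Fintype.card W → p * #S ≤ #(closedNbhd H S \ S))
    {S : Finset W} (hS : S.Nonempty) (r : ℕ) (hr : 2 * #(nball H r S) ≤ Fintype.card W) :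
    (1 + p) ^ r ≤ #(nball H r S) := by
  induction r with
  | zero => simpa [nball] using hS.card_pos
  | succ r ih =>
    rw [nball_succ] at hr ⊢
    have hsub : nball H r S ⊆ closedNbhd H (nball H r S) := subset_closedNbhd _
    have hle : 2 * #(nball H r S) ≤ Fintype.card W := by
      have := card_le_card hsub
      omega
    have h1 := ih hle
    have h2 := hexp _ hle
    have h3 : (#(closedNbhd H (nball H r S)) : ℝ) =
        #(closedNbhd H (nball H r S) \ nball H r S) + #(nball H r S) := by
      exact_mod_cast (card_sdiff_add_card_eq_card hsub).symm
    rw [pow_succ, h3]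
    nlinarith

end Balls

section Teams

/-- A deficiency version of Hall's theorem. -/
lemma exists_subset_card_biUnion_le_and_matching {α β : Type*} [DecidableEq α] [DecidableEq β]
    (A : Finset α) (t : α → Finset β) :
    ∃ B ⊆ A, #(B.biUnion t) ≤ #B ∧
      ∃ f : ↥(A \ B) → β, Function.Injective f ∧ ∀ x : ↥(A \ B), f x ∈ t x := by
  obtain ⟨B, hB, hmax⟩ := (A.powerset.filter fun B => #(B.biUnion t) ≤ #B).exists_max_image
    (fun B => #B) ⟨∅, by simp⟩
  rw [mem_filter, mem_powerset] at hB
  refine ⟨B, hB.1, hB.2, ?_⟩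
  refine (Finset.all_card_le_biUnion_card_iff_exists_injective
    (fun x : ↥(A \ B) => t x)).1 fun S => ?_
  rcases S.eq_empty_or_nonempty with rfl | hS
  · simp
  set S' : Finset α := S.map (Function.Embedding.subtype _) with hS'
  have hcard : #S' = #S := card_map _
  have hsub : S' ⊆ A \ B := by
    intro x hx
    obtain ⟨y, -, rfl⟩ := mem_map.1 hx
    exact y.2
  have hdisj : Disjoint B S' := disjoint_of_subset_right hsub disjoint_sdiff
  have hbi : S'.biUnion t = S.biUnion fun x => t x := by
    ext b
    simp [hS']
  have hunion : #(B ∪ S') = #B + #S' := card_union_of_disjoint hdisj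
  have hnot : ¬ #((B ∪ S').biUnion t) ≤ #(B ∪ S') := by
    intro hle
    have := hmax (B ∪ S') (mem_filter.2 ⟨mem_powerset.2
      (union_subset hB.1 (hsub.trans sdiff_subset)), hle⟩)
    have := hS.card_pos
    omega
  have hle : #((B ∪ S').biUnion t) ≤ #(B.biUnion t) + #(S'.biUnion t) := by
    rw [union_biUnion]
    exact card_union_le _ _
  rw [← hbi]
  omega

variable {W : Type*} [Fintype W] {H : SimpleGraph W}

open Classical in
/-- Within `τ` moves a team of cops occupies all of `A` except for a set with few
cops nearby. -/
lemma exists_team {k : ℕ} (H : SimpleGraph W) (home : Fin k → W) (τ : ℕ) (A : Finset W) :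
    ∃ B ⊆ A, #{i | home i ∈ nball H τ B} ≤ #B ∧ ∃ traj : Fin k → ℕ → W,
      (∀ i, traj i 0 = home i ∧ IsLazyWalk H (traj i)) ∧
      ∀ x ∈ A, x ∉ B → ∃ i, traj i τ = x := by
  obtain ⟨B, hBA, hB, f, hf, hft⟩ := exists_subset_card_biUnion_le_and_matching A
    (fun u => univ.filter fun i : Fin k => home i ∈ nball H τ {u})
  refine ⟨B, hBA, ?_, ?_⟩
  · convert hB using 2
    ext i
    simp [mem_nball_iff_singleton (S := B)]
  · have : ∀ i, ∃ h : ℕ → W, (h 0 = home i ∧ IsLazyWalk H h) ∧ ∀ x, f x = i → h τ = x := by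
      intro i
      by_cases hi : ∃ x, f x = i
      · obtain ⟨x, rfl⟩ := hi
        obtain ⟨h, hh, hh0, hhτ⟩ := exists_isLazyWalk_of_mem_nball (mem_filter.1 (hft x)).2
        exact ⟨h, ⟨hh0, hh⟩, fun y hy => by rw [hf hy]; exact hhτ _ le_rfl⟩
      · exact ⟨fun _ => home i, ⟨rfl, IsLazyWalk.const _⟩, fun x hx => absurd ⟨x, hx⟩ hi⟩
    choose traj htraj hx using this
    exact ⟨traj, htraj, fun x hxA hxB =>
      ⟨_, hx _ ⟨x, mem_sdiff.2 ⟨hxA, hxB⟩⟩ rfl⟩⟩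

open Classical in
/-- A random placement of `k` cops meets every set of a suitable family in many cops. -/
lemma exists_placement [Nonempty W] {k L : ℕ} {D : ℝ} (hL : 1 ≤ L)
    (Y : ℕ → Finset W → Finset W)
    (hD : Real.exp (-(D * k / (2 * Fintype.card W))) ≤ 1 / (8 * L * Fintype.card W)) :
    ∃ f : Fin k → W, ∀ s < L, ∀ S : Finset W, S.Nonempty → D * #S ≤ #(Y s S) →
      #S < #{i | f i ∈ Y s S} := by
  by_contra hcon
  push Not at hcon
  set m : ℝ := (Fintype.card W : ℝ) with hm
  have hmpos : 0 < m := by rw [hm]; exact_mod_cast Fintype.card_pos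
  have hLpos : (0 : ℝ) < L := by exact_mod_cast hL
  set F : Finset (ℕ × Finset W) := (range L ×ˢ univ).filter
    fun q => q.2.Nonempty ∧ D * #q.2 ≤ #(Y q.1 q.2) with hF
  set wt : ℕ × Finset W → W → ℝ := fun q v => if v ∈ Y q.1 q.2 then 1 / 2 else 1 with hwt
  have hwt0 : ∀ q v, 0 ≤ wt q v := by
    intro q v
    simp only [hwt]
    split_ifs <;> norm_num
  have hone : ∀ f : Fin k → W, 1 ≤ ∑ q ∈ F, (2 : ℝ) ^ #q.2 * ∏ i, wt q (f i) := by
    intro f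
    obtain ⟨s, hs, S, hS, hDS, hle⟩ := hcon f
    have hmem : (s, S) ∈ F := by simp [hF, hs, hS, hDS]
    refine le_trans ?_ (single_le_sum (f := fun q => (2 : ℝ) ^ #q.2 * ∏ i, wt q (f i))
      (fun q _ => mul_nonneg (by positivity) (prod_nonneg fun i _ => hwt0 q _)) hmem)
    simp only [hwt, prod_ite, prod_const, one_pow, mul_one]
    calc (1 : ℝ) = 2 ^ #S * (1 / 2) ^ #S := by rw [← mul_pow]; norm_num
      _ ≤ 2 ^ #S * (1 / 2) ^ #{i | f i ∈ Y s S} :=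
        mul_le_mul_of_nonneg_left (pow_le_pow_of_le_one (by norm_num) (by norm_num) hle)
          (by positivity)
  have hsum : ∀ q : ℕ × Finset W, ∑ v, wt q v = m - #(Y q.1 q.2) / 2 := by
    intro q
    have : ∀ v, wt q v = 1 - if v ∈ Y q.1 q.2 then 1 / 2 else 0 := by
      intro v
      simp only [hwt]
      split_ifs <;> norm_num
    simp only [this, sum_sub_distrib]
    simp [hm]
    ring
  have hterm : ∀ q ∈ F, (2 : ℝ) ^ #q.2 * (m - #(Y q.1 q.2) / 2) ^ k ≤
      m ^ k * (1 / (4 * L * m)) ^ #q.2 := by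
    intro q hq
    have hDq : D * #q.2 ≤ #(Y q.1 q.2) := (mem_filter.1 hq).2.2
    have hYm : (#(Y q.1 q.2) : ℝ) ≤ m := by rw [hm]; exact_mod_cast card_le_univ _
    have h1 : m - #(Y q.1 q.2) / 2 ≤ m * Real.exp (-(D * #q.2 / (2 * m))) := by
      have h := Real.add_one_le_exp (-(#(Y q.1 q.2) / (2 * m)) : ℝ)
      have h' : Real.exp (-(#(Y q.1 q.2) / (2 * m)) : ℝ) ≤
          Real.exp (-(D * #q.2 / (2 * m))) := by gcongr
      calc m - #(Y q.1 q.2) / 2 = m * (-(#(Y q.1 q.2) / (2 * m)) + 1) := by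
            field_simp
            ring
        _ ≤ _ := mul_le_mul_of_nonneg_left (h.trans h') hmpos.le
    have h2 : Real.exp (-(D * #q.2 / (2 * m))) ^ k =
        Real.exp (-(D * k / (2 * m))) ^ #q.2 := by
      rw [← Real.exp_nat_mul, ← Real.exp_nat_mul]
      congr 1
      ring
    calc (2 : ℝ) ^ #q.2 * (m - #(Y q.1 q.2) / 2) ^ k
        ≤ 2 ^ #q.2 * (m * Real.exp (-(D * #q.2 / (2 * m)))) ^ k := by
          gcongr
          linarith
      _ = m ^ k * (2 * Real.exp (-(D * k / (2 * m)))) ^ #q.2 := by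
          rw [mul_pow, h2, mul_pow]
          ring
      _ ≤ m ^ k * (2 * (1 / (8 * L * m))) ^ #q.2 := by gcongr
      _ = _ := by
          congr 2
          field_simp
          norm_num
  have hmain : m ^ k ≤ m ^ k * (L * ((1 + 1 / (4 * L * m)) ^ Fintype.card W - 1)) := by
    calc m ^ k = ∑ _f : Fin k → W, (1 : ℝ) := by simp [hm]
      _ ≤ ∑ f : Fin k → W, ∑ q ∈ F, (2 : ℝ) ^ #q.2 * ∏ i, wt q (f i) :=
        sum_le_sum fun f _ => hone f
      _ = ∑ q ∈ F, (2 : ℝ) ^ #q.2 * (m - #(Y q.1 q.2) / 2) ^ k := by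
        rw [sum_comm]
        refine sum_congr rfl fun q _ => ?_
        rw [← mul_sum, ← hsum, Fintype.sum_pow]
      _ ≤ ∑ q ∈ F, m ^ k * (1 / (4 * L * m)) ^ #q.2 := sum_le_sum hterm
      _ ≤ ∑ q ∈ range L ×ˢ (univ.erase ∅), m ^ k * (1 / (4 * L * m)) ^ #q.2 := by
        refine sum_le_sum_of_subset_of_nonneg ?_ fun _ _ _ => by positivity
        intro q hq
        obtain ⟨h1, h2, -⟩ := mem_filter.1 hq
        exact mem_product.2 ⟨(mem_product.1 h1).1, mem_erase.2 ⟨h2.ne_empty, mem_univ _⟩⟩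
      _ = _ := by
        have h := Fintype.sum_pow_mul_eq_add_pow W (1 / (4 * L * m)) (1 : ℝ)
        simp only [one_pow, mul_one] at h
        rw [sum_product]
        simp only [sum_const, card_range, ← mul_sum, nsmul_eq_mul]
        rw [add_comm (1 : ℝ), ← h, ← add_sum_erase _ _ (mem_univ (∅ : Finset W))]
        simp
        ring
  have hexp : (1 + 1 / (4 * L * m)) ^ Fintype.card W ≤ Real.exp (1 / (4 * L)) := by
    calc (1 + 1 / (4 * L * m)) ^ Fintype.card W
        ≤ Real.exp (1 / (4 * L * m)) ^ Fintype.card W := by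
          gcongr
          rw [add_comm]
          exact Real.add_one_le_exp _
      _ = Real.exp (1 / (4 * L)) := by
          rw [← Real.exp_nat_mul, ← hm]
          congr 1
          field_simp
  have hy : (1 : ℝ) / (4 * L) ≤ 1 / 4 := by
    have : (1 : ℝ) ≤ L := by exact_mod_cast hL
    rw [div_le_div_iff₀ (by positivity) (by norm_num)]
    linarith
  have hy0 : (0 : ℝ) < 1 / (4 * L) := by positivity
  have h3 := Real.abs_exp_sub_one_le (x := 1 / (4 * L)) (by rw [abs_of_pos hy0]; linarith)
  rw [abs_of_pos hy0] at h3
  have h4 : Real.exp (1 / (4 * L)) - 1 ≤ 2 * (1 / (4 * L)) := (le_abs_self _).trans h3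
  have h5 : L * ((1 + 1 / (4 * L * m)) ^ Fintype.card W - 1) ≤ 1 / 2 := by
    calc L * ((1 + 1 / (4 * L * m)) ^ Fintype.card W - 1) ≤ L * (2 * (1 / (4 * L))) := by
          gcongr
          linarith
      _ = 1 / 2 := by
          field_simp
          norm_num
  have hmk : 0 < m ^ k := by positivity
  nlinarith

end Teams

section Stages

/-- The number of steps made by the robber before the `s`-th stage of the chase. -/
def stageStart (R : ℕ) : ℕ → ℕ
  | 0 => 0
  | s + 1 => stageStart R s + (stageStart R s / R + 1)

/-- The number of moves the cops make before the robber is able to make more than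
`stageStart R s` steps. -/
def stageTime (R s : ℕ) : ℕ := stageStart R s / R + 1

lemma stageStart_succ (R s : ℕ) : stageStart R (s + 1) = stageStart R s + stageTime R s := rfl

lemma stageTime_mono (R : ℕ) : Monotone (stageTime R) :=
  monotone_nat_of_le_succ fun _ =>
    Nat.succ_le_succ (Nat.div_le_div_right (Nat.le_add_right _ _))

lemma pow_le_stageStart {R : ℕ} (hR : 1 ≤ R) (s : ℕ) :
    (1 + 1 / (R : ℝ)) ^ s ≤ stageStart R (s + 1) := by
  have hR' : (0 : ℝ) < R := by exact_mod_cast hR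
  induction s with
  | zero => simp [stageStart]
  | succ s ih =>
    rw [stageStart_succ, stageTime, pow_succ]
    have h : stageStart R (s + 1) ≤ R * (stageStart R (s + 1) / R + 1) :=
      (Nat.lt_mul_div_succ _ hR).le
    have h' : (stageStart R (s + 1) : ℝ) / R ≤ (stageStart R (s + 1) / R + 1 : ℕ) := by
      rw [div_le_iff₀ hR', mul_comm]
      exact_mod_cast h
    calc (1 + 1 / (R : ℝ)) ^ s * (1 + 1 / R) ≤ stageStart R (s + 1) * (1 + 1 / R) := by gcongr
      _ = stageStart R (s + 1) + stageStart R (s + 1) / R := by ring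
      _ ≤ _ := by push_cast at h' ⊢; linarith

lemma pow_div_le_stageTime {R : ℕ} (hR : 1 ≤ R) (s : ℕ) :
    (1 + 1 / (R : ℝ)) ^ s / R ≤ stageTime R (s + 1) := by
  have hR' : (0 : ℝ) < R := by exact_mod_cast hR
  rw [div_le_iff₀ hR']
  refine (pow_le_stageStart hR s).trans ?_
  rw [mul_comm]
  exact_mod_cast (Nat.lt_mul_div_succ (stageStart R (s + 1)) hR).le

end Stages

section Chase

open Classical in
/-- In an expanding graph, `L + 1` teams of `k` cops have a placement from which they catch the
robber along trajectories that depend only on his starting vertex. -/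
lemma exists_trajectories_of_expanding {W : Type*} [Fintype W] [Nonempty W] (H : SimpleGraph W)
    {R k L : ℕ} (hR : 1 ≤ R) {p D : ℝ} (hp : 0 < p) (hD0 : 0 ≤ D)
    (hexp : ∀ S : Finset W, 2 * #S ≤ Fintype.card W → p * #S ≤ #(closedNbhd H S \ S))
    (hD : Real.exp (-(D * k / (2 * Fintype.card W))) ≤ 1 / (8 * ↑(L + 1) * Fintype.card W))
    (hDL : 2 * D ^ (L + 1) ≤ Fintype.card W)
    (hgrow : (Fintype.card W : ℝ) < 2 * (1 + p) ^ stageTime R L) :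
    ∃ home : Fin ((L + 1) * k) → W, ∀ v, ∃ C : Fin ((L + 1) * k) → ℕ → W,
      (∀ i, C i 0 = home i ∧ IsLazyWalk H (C i)) ∧ ∀ g, IsLazyWalk H g → g 0 = v →
        ¬ Evades R (fun T i => C i T) (stageTime R L) g := by
  obtain ⟨f, hf⟩ := exists_placement (Nat.succ_pos L)
    (fun s => nball H (stageTime R s)) hD
  choose bad hsub hbad traj htraj hocc using fun s A => exists_team H f (stageTime R s) A
  refine ⟨fun i => f (finProdFinEquiv.symm i).2, fun v => ?_⟩
  let U : ℕ → Finset W :=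
    Nat.rec (bad 0 {v}) fun s => bad (s + 1) ∘ nball H (stageTime R s)
  let A : ℕ → Finset W :=
    fun s => Nat.casesOn s {v} fun s => nball H (stageTime R s) (U s)
  have hUA : ∀ s, U s = bad s (A s) := by rintro (_ | s) <;> rfl
  have hball : ∀ s ≤ L, (#(nball H (stageTime R s) (U s)) : ℝ) ≤ D * #(U s) := by
    intro s hs
    rcases (U s).eq_empty_or_nonempty with h | h
    · have : nball H (stageTime R s) (∅ : Finset W) = ∅ := by
        ext w
        rw [mem_nball_iff_singleton]
        simp
      simp [h, this]
    · by_contra hlt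
      have h1 := hf s (Nat.lt_succ_of_le hs) (U s) h (not_le.1 hlt).le
      have h2 := hbad s (A s)
      rw [← hUA] at h2
      omega
  have hcard : ∀ s ≤ L, (#(U s) : ℝ) ≤ D ^ s := by
    intro s
    induction s with
    | zero =>
      intro _
      have h : #(U 0) ≤ #({v} : Finset W) := card_le_card (hsub 0 {v})
      simpa using h
    | succ s ih =>
      intro hs
      have h : #(U (s + 1)) ≤ #(nball H (stageTime R s) (U s)) :=
        card_le_card (hsub (s + 1) _)
      have h' : (#(U (s + 1)) : ℝ) ≤ #(nball H (stageTime R s) (U s)) := by exact_mod_cast h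
      calc (#(U (s + 1)) : ℝ) ≤ D * #(U s) := h'.trans (hball s (by omega))
        _ ≤ D * D ^ s := mul_le_mul_of_nonneg_left (ih (by omega)) hD0
        _ = D ^ (s + 1) := by ring
  refine ⟨fun i => traj (finProdFinEquiv.symm i).1 (A (finProdFinEquiv.symm i).1)
    (finProdFinEquiv.symm i).2, fun i => htraj _ _ _, fun g hg hg0 hev => ?_⟩
  have hmem : ∀ s ≤ L, g (stageStart R s) ∈ A s → g (stageStart R s) ∈ U s := by
    intro s hs hA
    rw [hUA]
    by_contra hnot
    obtain ⟨i, hi⟩ := hocc s (A s) _ hA hnot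
    have h := hev (stageStart R s / R) (stageTime_mono R hs) (stageStart R s % R)
        (Nat.mod_lt _ hR).le (finProdFinEquiv (⟨s, Nat.lt_succ_of_le hs⟩, i))
    rw [Nat.div_add_mod'] at h
    simp only [Equiv.symm_apply_apply] at h
    exact h hi
  have hin : ∀ s ≤ L, g (stageStart R s) ∈ U s := by
    intro s
    induction s with
    | zero =>
      intro hs
      exact hmem 0 hs (by simp [A, stageStart, hg0])
    | succ s ih =>
      intro hs
      refine hmem _ hs ?_
      rw [stageStart_succ]
      exact hg.mem_nball (ih (by omega)) _
  have hne : (U L).Nonempty := ⟨_, hin L le_rfl⟩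
  have hle : 2 * (#(nball H (stageTime R L) (U L)) : ℝ) ≤ Fintype.card W := by
    calc 2 * (#(nball H (stageTime R L) (U L)) : ℝ) ≤ 2 * (D * D ^ L) := by
          have := mul_le_mul_of_nonneg_left (hcard L le_rfl) hD0
          linarith [hball L le_rfl]
      _ = 2 * D ^ (L + 1) := by ring
      _ ≤ _ := hDL
  have := pow_le_card_nball hp hexp hne (stageTime R L) (by exact_mod_cast hle)
  linarith

end Chase

section Guards

variable {V : Type*} [Fintype V] {G : SimpleGraph V} {R c : ℕ}

lemma exists_embedding_avoiding {k : ℕ} (I : Finset (Fin c)) (h : #I + k ≤ c) :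
    ∃ e : Fin k → Fin c, Function.Injective e ∧ ∀ a, e a ∉ I := by
  have hcard : Fintype.card (Fin k) ≤ Fintype.card ↥(Iᶜ) := by
    simp
    omega
  obtain ⟨e⟩ := Function.Embedding.nonempty_of_card_le hcard
  exact ⟨fun a => e a, fun a b hab => e.injective (Subtype.ext hab),
    fun a => mem_compl.1 (e a).2⟩

open Classical in
/-- The cops win inside a guarded set once they outnumber its guards sufficiently. -/
lemma copsWinR_of_guarded (hG : G.Connected) (hR : 1 ≤ R) {k L : ℕ} {p D : ℝ} (hp : 0 < p)
    (hD0 : 0 ≤ D)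
    (hD : ∀ m : ℕ, (L + 1) * k < m → m ≤ Fintype.card V →
      Real.exp (-(D * k / (2 * m))) ≤ 1 / (8 * ↑(L + 1) * m))
    (hDL : ∀ m : ℕ, (L + 1) * k < m → m ≤ Fintype.card V → 2 * D ^ (L + 1) ≤ m)
    (hgrow : ∀ m : ℕ, m ≤ Fintype.card V → (m : ℝ) < 2 * (1 + p) ^ stageTime R L)
    (U : Finset V) (C : Fin c → V) (I : Finset (Fin c))
    (hguard : ∀ u ∈ U, ∀ w ∉ U, G.Adj u w → ∃ i ∈ I, C i = w)
    (hc : #I + p * #U + ((L + 1) * k : ℕ) ≤ c) {r : V} (hr : r ∈ U) :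
    CopsWinR G R c C r := by
  induction hn : #U using Nat.strong_induction_on generalizing U C I r with
  | _ n ih =>
  subst hn
  have hpU : 0 ≤ p * #U := by positivity
  have hIK : #I + (L + 1) * k ≤ c := by
    have : (#I : ℝ) + ((L + 1) * k : ℕ) ≤ c := by linarith
    exact_mod_cast this
  have hcatch : ∀ {C' : Fin c → V} {r' : V}, (∃ i, C' i = r') → CopsWinR G R c C' r' := by
    rintro C' r' ⟨i, hi⟩
    exact CopsWinR.catch C' C' r' (fun _ => Or.inl rfl) i hi
  have hextend : ∀ {l : ℕ} {e : Fin l → Fin c}, (∀ a, e a ∉ I) → ∀ (h : Fin l → V),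
      ∀ i ∈ I, Function.extend e h C i = C i := by
    intro l e he h i hi
    exact Function.extend_apply' _ _ _ (by rintro ⟨a, rfl⟩; exact he a hi)
  have hmove : ∀ {l : ℕ} {e : Fin l → Fin c}, (∀ a, e a ∉ I) → ∀ (h : Fin l → V),
      (∀ r ∈ U, CopsWinR G R c (Function.extend e h C) r) → CopsWinR G R c C r := by
    intro l e he h hwin
    refine copsWinR_of_reposition hG hR ?_ hwin hr
    intro u hu w hw huw
    obtain ⟨i, hi, hiw⟩ := hguard u hu w hw huw
    exact ⟨i, hiw, by rw [hextend he h i hi, hiw]⟩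
  rcases le_or_gt #U ((L + 1) * k) with hsmall | hlarge
  · obtain ⟨e, he, heI⟩ := exists_embedding_avoiding (k := #U) I (by omega)
    refine hmove heI (fun a => U.equivFin.symm a) fun r' hr' => hcatch ?_
    exact ⟨e (U.equivFin ⟨r', hr'⟩), by rw [he.extend_apply]; simp⟩
  set H : SimpleGraph U := G.comap Subtype.val with hH
  by_cases hexp : ∀ S : Finset U, 2 * #S ≤ Fintype.card U → p * #S ≤ #(closedNbhd H S \ S)
  · have : Nonempty U := ⟨⟨r, hr⟩⟩
    have hUc : #U ≤ Fintype.card V := card_le_univ U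
    obtain ⟨home, hhome⟩ := exists_trajectories_of_expanding (k := k) (L := L) H hR hp hD0
      (fun S hS => by convert hexp S hS) (by simpa using hD _ hlarge hUc)
      (by simpa using hDL _ hlarge hUc)
      (by simpa using hgrow _ hUc)
    obtain ⟨e, he, heI⟩ := exists_embedding_avoiding I hIK
    refine hmove heI (fun a => home a) fun v hv => ?_
    obtain ⟨P, hP, hcap⟩ := hhome ⟨v, hv⟩
    set Q : ℕ → Fin c → V := fun T => Function.extend e (fun a => (P a T : V)) C with hQ
    have hQ0 : Q 0 = Function.extend e (fun a => (home a : V)) C := by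
      simp only [hQ, (hP _).1]
    rw [← hQ0]
    refine copsWinR_of_evades (N := stageTime R L) ?_ ?_
    · intro T i
      by_cases hi : ∃ a, e a = i
      · obtain ⟨a, rfl⟩ := hi
        simp only [hQ, he.extend_apply]
        exact ((hP a).2 T).imp (congrArg Subtype.val) id
      · left
        simp only [hQ, Function.extend_apply' _ _ _ hi]
    · intro g hg hg0 hev
      exfalso
      have hgU := hev.mem_of_guarded hR hg (U := U) (by rwa [hg0]) (by
        intro u hu w hw huw T
        obtain ⟨i, hi, hiw⟩ := hguard u hu w hw huw
        exact ⟨i, by rw [← hiw]; exact hextend heI _ i hi⟩)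
      refine hcap (fun t => ⟨_, hgU (min t (stageTime R L * R)) (min_le_right _ _)⟩) ?_ ?_ ?_
      · intro t
        exact (hg.comp_min (stageTime R L * R) t).imp Subtype.ext id
      · exact Subtype.ext (by simpa using hg0)
      · intro T hT j hj i h
        refine hev T hT j hj (e i) ?_
        have hTj : T * R + j ≤ stageTime R L * R := by
          calc T * R + j ≤ (T + 1) * R := by rw [add_mul, one_mul]; omega
            _ ≤ _ := Nat.mul_le_mul_right _ hT
        have h' := congrArg Subtype.val h
        simp only [min_eq_left hTj] at h'
        simp only [hQ, he.extend_apply]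
        exact h'
  · push Not at hexp
    obtain ⟨S, hS, hSB⟩ := hexp
    set B : Finset U := closedNbhd H S \ S with hB
    have hSpos : 0 < #S := by
      rw [Nat.pos_iff_ne_zero]
      intro h
      rw [h] at hSB
      have : (0 : ℝ) ≤ #B := by positivity
      simp at hSB
      linarith
    rw [Fintype.card_coe] at hS
    have hpS : p * #S ≤ p * #U := by
      gcongr
      omega
    obtain ⟨e, he, heI⟩ := exists_embedding_avoiding (k := #B) I (by
      have h0 : (0 : ℝ) ≤ ((L + 1) * k : ℕ) := by positivity
      have : (#I : ℝ) + #B ≤ c := by linarith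
      exact_mod_cast this)
    refine hmove heI (fun a => ((B.equivFin.symm a : U) : V)) fun r' hr' => ?_
    set C' := Function.extend e (fun a => ((B.equivFin.symm a : U) : V)) C with hC'
    have hoccB : ∀ x : U, x ∈ B → ∃ i ∈ I ∪ univ.image e, C' i = x := by
      intro x hx
      exact ⟨e (B.equivFin ⟨x, hx⟩), by simp, by rw [hC', he.extend_apply]; simp⟩
    have hoccI : ∀ u ∈ U, ∀ w ∉ U, G.Adj u w → ∃ i ∈ I ∪ univ.image e, C' i = w := by
      intro u hu w hw huw
      obtain ⟨i, hi, hiw⟩ := hguard u hu w hw huw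
      exact ⟨i, mem_union_left _ hi, by rw [hC', hextend heI _ i hi, hiw]⟩
    have hI' : #(I ∪ univ.image e) ≤ #I + #B := by
      refine (card_union_le _ _).trans ?_
      rw [card_image_of_injective _ he]
      simp
    have hI'r : (#(I ∪ univ.image e) : ℝ) ≤ #I + #B := by exact_mod_cast hI'
    have hrec : ∀ X : Finset U, #X + #S ≤ #U →
        (∀ u ∈ X, ∀ w ∉ X, H.Adj u w → w ∈ B) → (⟨r', hr'⟩ : U) ∈ X → CopsWinR G R c C' r' := by
      intro X hX hXB hrX
      have hcardX : #(X.map (Function.Embedding.subtype _)) = #X := card_map _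
      refine ih _ (by omega) (X.map (Function.Embedding.subtype _)) C' (I ∪ univ.image e)
        ?_ ?_ (mem_map.2 ⟨_, hrX, rfl⟩) rfl
      · intro u hu w hw huw
        obtain ⟨x, hx, rfl⟩ := mem_map.1 hu
        by_cases hwU : w ∈ U
        · exact hoccB ⟨w, hwU⟩ (hXB x hx ⟨w, hwU⟩
            (fun h => hw (mem_map.2 ⟨_, h, rfl⟩)) huw)
        · exact hoccI x x.2 w hwU huw
      · rw [hcardX]
        have h1 : (#X : ℝ) + #S ≤ #U := by exact_mod_cast hX
        have h2 := mul_le_mul_of_nonneg_left h1 hp.le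
        rw [mul_add] at h2
        linarith
    by_cases hrS : (⟨r', hr'⟩ : U) ∈ S
    · refine hrec S (by omega) ?_ hrS
      intro u hu w hw huw
      exact mem_sdiff.2 ⟨mem_closedNbhd.2 ⟨u, hu, Or.inr huw⟩, hw⟩
    · by_cases hrB : (⟨r', hr'⟩ : U) ∈ B
      · obtain ⟨i, -, hi⟩ := hoccB _ hrB
        exact hcatch ⟨i, hi⟩
      · refine hrec (univ \ (closedNbhd H S)) ?_ ?_ ?_
        · have h1 := card_sdiff_add_card_eq_card (subset_univ (closedNbhd H S))
          have h2 := card_le_card (subset_closedNbhd (H := H) S)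
          rw [card_univ, Fintype.card_coe] at h1
          omega
        · intro u hu w hw huw
          simp only [mem_sdiff, mem_univ, true_and, not_not] at hu hw
          exact mem_sdiff.2 ⟨hw, fun hwS => hu (mem_closedNbhd.2 ⟨w, hwS, Or.inr huw.symm⟩)⟩
        · simp only [mem_sdiff, mem_univ, true_and]
          exact fun h => hrB (mem_sdiff.2 ⟨h, hrS⟩)

end Guards

section Parameters

/-- Winning from one placement against every starting vertex bounds the cop number. -/
lemma copNumberR_le {V : Type*} {G : SimpleGraph V} {R c : ℕ} {C₀ : Fin c → V}
    (h : ∀ r, CopsWinR G R c C₀ r) : copNumberR G R ≤ c :=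
  Nat.sInf_le ⟨C₀, h⟩

lemma exp_half_le_one_add {p : ℝ} (hp : 0 ≤ p) (hp1 : p ≤ 1) : Real.exp (p / 2) ≤ 1 + p := by
  have h := Real.exp_bound_div_one_sub_of_interval (x := p / 2) (by linarith) (by linarith)
  refine h.trans ?_
  rw [div_le_iff₀ (by linarith)]
  nlinarith

set_option maxHeartbeats 1000000 in
/-- The parameters of the chase in an `n`-vertex graph, where `n = α ^ (s ^ 2)`, `α = exp a`. -/
lemma exists_parameters {R n : ℕ} (hR : 1 ≤ R) {a δ s : ℝ} (ha : a = Real.log (1 + 1 / (R : ℝ)))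
    (hδ : 0 < δ) (hδ1 : δ ≤ 1 / 4) (hn : (n : ℝ) = Real.exp (a * s ^ 2)) (hs8 : 8 ≤ s)
    (hsa : 4 * (R * a) ≤ s) (hsδ : 1 + 4 * a ≤ a * δ * s)
    (hexp : s ^ 3 ≤ Real.exp (a * δ * s)) :
    ∃ (k L : ℕ) (p D : ℝ), 0 < p ∧ 0 ≤ D ∧
      (∀ m : ℕ, (L + 1) * k < m → m ≤ n →
        Real.exp (-(D * k / (2 * m))) ≤ 1 / (8 * ↑(L + 1) * m)) ∧
      (∀ m : ℕ, (L + 1) * k < m → m ≤ n → 2 * D ^ (L + 1) ≤ m) ∧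
      (∀ m : ℕ, m ≤ n → (m : ℝ) < 2 * (1 + p) ^ stageTime R L) ∧
      p * n + ((L + 1) * k : ℕ) + 1 ≤ Real.exp (a * (s ^ 2 - (1 - 4 * δ) * s)) := by
  have hR' : (1 : ℝ) ≤ R := by exact_mod_cast hR
  have hα : 0 < 1 / (R : ℝ) := by positivity
  have ha0 : 0 < a := by
    rw [ha]
    exact Real.log_pos (by linarith)
  have hα' : (1 + 1 / (R : ℝ)) = Real.exp a := by
    rw [ha, Real.exp_log (by linarith)]
  have has : 4 * a ≤ s := by nlinarith
  have hs2 : s ≤ s ^ 2 := by nlinarith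
  have haδ : a * δ * s ≤ a * s ^ 2 := by
    have : a * δ * s ≤ a * 1 * s := by gcongr; linarith
    nlinarith
  set l : ℕ := ⌈(1 - δ) * s⌉₊ with hl
  have hb0 : 0 ≤ (1 - δ) * s := mul_nonneg (by linarith) (by linarith)
  have hl1 : (1 - δ) * s ≤ l := Nat.le_ceil _
  have hl2 : (l : ℝ) ≤ (1 - δ) * s + 1 := (Nat.ceil_lt_add_one hb0).le
  have hl3 : (l : ℝ) + 2 ≤ s + 3 := by nlinarith
  set p : ℝ := Real.exp (-(a * (1 - 2 * δ) * s)) with hp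
  have hp0 : 0 < p := Real.exp_pos _
  have hp1 : p ≤ 1 := by
    rw [hp, Real.exp_le_one_iff, neg_nonpos]
    exact mul_nonneg (mul_nonneg ha0.le (by linarith)) (by linarith)
  have hn0 : (0 : ℝ) < n := hn ▸ Real.exp_pos _
  have hpn : p * n = Real.exp (a * s ^ 2 - a * (1 - 2 * δ) * s) := by
    rw [hp, hn, ← Real.exp_add]
    congr 1
    ring
  have hpn1 : 1 ≤ p * n := by
    rw [hpn]
    refine Real.one_le_exp ?_
    nlinarith [mul_pos ha0 hδ]
  set K : ℝ := Real.log (8 * (l + 2 : ℝ) * n) with hK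
  have hK0 : 0 ≤ K := by
    refine Real.log_nonneg ?_
    have : 1 ≤ (n : ℝ) := by
      rw [hn]
      exact Real.one_le_exp (by positivity)
    nlinarith [(Nat.cast_nonneg l : (0 : ℝ) ≤ l)]
  have hK1 : K ≤ 2 * (a * s ^ 2) := by
    rw [hK, Real.log_le_iff_le_exp (by positivity), two_mul, Real.exp_add, ← hn]
    refine mul_le_mul_of_nonneg_right ?_ hn0.le
    calc 8 * (l + 2 : ℝ) ≤ s ^ 3 := by nlinarith
      _ ≤ Real.exp (a * s ^ 2) := hexp.trans (Real.exp_le_exp.2 haδ)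
      _ = n := hn.symm
  set D : ℝ := 2 / p * K with hD
  have hD0 : 0 ≤ D := by positivity
  have hDle : D ≤ Real.exp (a * (1 - δ) * s) := by
    have h1 : 2 / p = 2 * Real.exp (a * (1 - 2 * δ) * s) := by
      rw [hp, Real.exp_neg]
      field_simp
    have h2 : 2 * K ≤ Real.exp (a * δ * s) := by
      refine le_trans ?_ hexp
      nlinarith [sq_nonneg s]
    calc D = 2 * K * Real.exp (a * (1 - 2 * δ) * s) := by rw [hD, h1]; ring
      _ ≤ Real.exp (a * δ * s) * Real.exp (a * (1 - 2 * δ) * s) := by gcongr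
      _ = _ := by rw [← Real.exp_add]; congr 1; ring
  have hDpow : 2 * D ^ (l + 2) ≤ p * n := by
    have h2 : (2 : ℝ) ≤ Real.exp 1 := by linarith [Real.add_one_le_exp (1 : ℝ)]
    calc 2 * D ^ (l + 2) ≤ Real.exp 1 * Real.exp (a * (1 - δ) * s) ^ (l + 2) := by gcongr
      _ = Real.exp (1 + (l + 2) * (a * (1 - δ) * s)) := by
          rw [← Real.exp_nat_mul, ← Real.exp_add]
          push_cast
          rfl
      _ ≤ p * n := by
          rw [hpn, Real.exp_le_exp]
          have h3 : (l + 2 : ℝ) * (a * (1 - δ) * s) ≤ ((1 - δ) * s + 3) * (a * s) := by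
            have h4 : a * (1 - δ) * s ≤ a * s := by nlinarith [mul_pos ha0 hδ]
            exact mul_le_mul (by linarith) h4 (by nlinarith) (by linarith)
          nlinarith [mul_pos ha0 hδ]
  have hkle : p * n ≤ ⌈p * n⌉₊ := Nat.le_ceil _
  have hklt : (⌈p * n⌉₊ : ℝ) ≤ p * n + 1 := (Nat.ceil_lt_add_one (by positivity)).le
  refine ⟨⌈p * n⌉₊, l + 1, p, D, hp0, hD0, ?_, ?_, ?_, ?_⟩
  · intro m hm hmn
    have hm0 : (0 : ℝ) < m := by exact_mod_cast (Nat.zero_le _).trans_lt hm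
    have hmn' : (m : ℝ) ≤ n := by exact_mod_cast hmn
    have h1 : K ≤ D * ⌈p * n⌉₊ / (2 * m) := by
      rw [le_div_iff₀ (by positivity)]
      calc K * (2 * m) ≤ K * (2 * n) := by gcongr
        _ = D * (p * n) := by
          rw [hD]
          field_simp
        _ ≤ _ := by gcongr
    calc Real.exp (-(D * ⌈p * n⌉₊ / (2 * m))) ≤ Real.exp (-K) :=
          Real.exp_le_exp.2 (neg_le_neg h1)
      _ = 1 / (8 * (l + 2 : ℝ) * n) := by
          rw [Real.exp_neg, hK, Real.exp_log (by positivity), one_div]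
      _ ≤ 1 / (8 * (l + 2 : ℝ) * m) := by gcongr
      _ = _ := by
          push_cast
          ring_nf
  · intro m hm _
    refine hDpow.trans (hkle.trans ?_)
    exact_mod_cast (Nat.le_mul_of_pos_left _ (Nat.succ_pos _)).trans hm.le
  · intro m hmn
    have hmn' : (m : ℝ) ≤ n := by exact_mod_cast hmn
    have h1 : Real.exp (a * (1 - δ) * s) / R ≤ stageTime R (l + 1) := by
      refine le_trans ?_ (pow_div_le_stageTime hR l)
      rw [hα', ← Real.exp_nat_mul]
      refine div_le_div_of_nonneg_right (Real.exp_le_exp.2 ?_) (by linarith)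
      calc a * (1 - δ) * s = (1 - δ) * s * a := by ring
        _ ≤ l * a := by gcongr
    have h2 : a * s ^ 2 ≤ stageTime R (l + 1) * (p / 2) := by
      calc a * s ^ 2 ≤ Real.exp (a * δ * s) / (2 * R) := by
            rw [le_div_iff₀ (by positivity)]
            refine le_trans ?_ hexp
            nlinarith [sq_nonneg s, mul_pos ha0 (lt_of_lt_of_le one_pos hR')]
        _ = Real.exp (a * (1 - δ) * s) / R * (p / 2) := by
            have : Real.exp (a * δ * s) = Real.exp (a * (1 - δ) * s) * p := by
              rw [hp, ← Real.exp_add]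
              congr 1
              ring
            rw [this]
            field_simp
        _ ≤ _ := by gcongr
    have h3 : (n : ℝ) ≤ (1 + p) ^ stageTime R (l + 1) := by
      calc (n : ℝ) ≤ Real.exp (stageTime R (l + 1) * (p / 2)) := hn ▸ Real.exp_le_exp.2 h2
        _ = Real.exp (p / 2) ^ stageTime R (l + 1) := Real.exp_nat_mul _ _
        _ ≤ _ := by
          gcongr
          exact exp_half_le_one_add hp0.le hp1
    linarith
  · have h1 : (((l + 1 + 1) * ⌈p * n⌉₊ : ℕ) : ℝ) ≤ (s + 3) * (p * n + 1) := by
      push_cast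
      exact mul_le_mul (by linarith) hklt (by positivity) (by linarith)
    have h2 : p * n + (s + 3) * (p * n + 1) + 1 ≤ s ^ 3 * (p * n) := by
      have h3 : 2 * s + 8 ≤ s ^ 3 := by nlinarith
      nlinarith
    calc p * n + ((l + 1 + 1) * ⌈p * n⌉₊ : ℕ) + 1 ≤ s ^ 3 * (p * n) := by linarith
      _ ≤ Real.exp (a * δ * s) * (p * n) := by gcongr
      _ ≤ _ := by
        rw [hpn, ← Real.exp_add, Real.exp_le_exp]
        nlinarith [mul_pos ha0 hδ]

end Parameters

/-- For fixed speed `R ≥ 1` and `α = 1 + 1/R`, every connected graph on `n`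
vertices (`n` large depending on `ε`) has speed-`R` cop number at most
`n / α^((1-ε)·√(log_α n))`. -/
theorem copNumberR_upper_bound (R : ℕ) (hR : 1 ≤ R) :
    ∀ ε : ℝ, 0 < ε → ∃ N : ℕ, ∀ n : ℕ, N ≤ n →
      ∀ (V : Type) [Fintype V], Fintype.card V = n →
        ∀ G : SimpleGraph V, G.Connected →
          (copNumberR G R : ℝ) ≤
            n / (1 + 1 / (R : ℝ)) ^ ((1 - ε) * Real.sqrt (Real.logb (1 + 1 / (R : ℝ)) n)) := by
  have hR' : (0 : ℝ) < R := by exact_mod_cast hR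
  have hα : 1 < 1 + 1 / (R : ℝ) := by
    have : 0 < 1 / (R : ℝ) := by positivity
    linarith
  intro ε hε
  set α : ℝ := 1 + 1 / (R : ℝ) with hαdef
  have hα0 : 0 < α := by linarith
  set a : ℝ := Real.log α with ha
  have ha0 : 0 < a := Real.log_pos hα
  set δ : ℝ := min ε 1 / 4 with hδ
  have hδ0 : 0 < δ := by positivity
  have hδ1 : δ ≤ 1 / 4 := by
    have := min_le_right ε 1
    rw [hδ]
    linarith
  have hδε : 4 * δ ≤ ε := by
    have := min_le_left ε 1
    rw [hδ]
    linarith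
  obtain ⟨S, hS⟩ := Filter.eventually_atTop.1
    ((((isLittleO_pow_exp_pos_mul_atTop (k := 3) (mul_pos ha0 hδ0)).bound one_pos).and
      ((Filter.eventually_ge_atTop 8).and (Filter.eventually_ge_atTop (4 * (R * a))))).and
      (Filter.eventually_ge_atTop ((1 + 4 * a) / (a * δ))))
  refine ⟨⌈α ^ (S ^ 2)⌉₊ + 1, fun n hn V _ hV G hG => ?_⟩
  have hn0 : (0 : ℝ) < n := by exact_mod_cast (Nat.succ_pos _).trans_le hn
  set s : ℝ := Real.sqrt (Real.logb α n) with hs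
  have hlog : S ^ 2 ≤ Real.logb α n := by
    rw [Real.le_logb_iff_rpow_le hα hn0]
    calc α ^ (S ^ 2) ≤ ⌈α ^ (S ^ 2)⌉₊ := Nat.le_ceil _
      _ ≤ n := by exact_mod_cast (Nat.le_succ _).trans hn
  obtain ⟨⟨hs3, hs8, hsa⟩, hsδ⟩ := hS s (Real.le_sqrt_of_sq_le hlog)
  have hs0 : 0 ≤ s := by linarith
  have hsq : s ^ 2 = Real.logb α n := Real.sq_sqrt ((sq_nonneg S).trans hlog)
  have hnexp : (n : ℝ) = Real.exp (a * s ^ 2) := by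
    rw [hsq, ← Real.rpow_def_of_pos hα0, Real.rpow_logb hα0 hα.ne' hn0]
  rw [Real.norm_of_nonneg (by positivity), Real.norm_of_nonneg (by positivity), one_mul] at hs3
  rw [div_le_iff₀ (by positivity)] at hsδ
  obtain ⟨k, L, p, D, hp, hD0, hD, hDL, hgrow, hbound⟩ :=
    exists_parameters hR ha hδ0 hδ1 hnexp hs8 hsa (by linarith) hs3
  subst hV
  have hne := hG.nonempty
  have hle : copNumberR G R ≤ ⌈p * Fintype.card V + ((L + 1) * k : ℕ)⌉₊ :=
    copNumberR_le (C₀ := fun _ => Classical.arbitrary V) fun r =>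
      copsWinR_of_guarded hG hR hp hD0 hD hDL hgrow univ _ ∅ (by simp)
        (by simpa using Nat.le_ceil (p * Fintype.card V + ((L + 1) * k : ℕ))) (mem_univ r)
  calc (copNumberR G R : ℝ) ≤ ⌈p * Fintype.card V + ((L + 1) * k : ℕ)⌉₊ := by exact_mod_cast hle
    _ ≤ p * Fintype.card V + ((L + 1) * k : ℕ) + 1 :=
      (Nat.ceil_lt_add_one (by positivity)).le
    _ ≤ Real.exp (a * (s ^ 2 - (1 - 4 * δ) * s)) := hbound
    _ ≤ Real.exp (a * s ^ 2 - a * ((1 - ε) * s)) := by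
      rw [Real.exp_le_exp]
      have : (1 - ε) * s ≤ (1 - 4 * δ) * s := by gcongr
      nlinarith
    _ = Fintype.card V / α ^ ((1 - ε) * s) := by
      rw [Real.exp_sub, ← hnexp, Real.rpow_def_of_pos hα0]
end

section
/- There exists N such that for every n ≥ N there is a connected graph G on n vertices whose infinite-speed cop number satisfies c_∞(G) ≥ n / 800². -/
/-- A legal move of an infinitely fast robber from `u` to `v`, with the cops
at positions `C`: a walk from `u` to `v` all of whose vertices after the
starting one avoid the cops. -/
def RobberMoveInf {V : Type*} (G : SimpleGraph V) {c : ℕ} (C : Fin c → V)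
    (u v : V) : Prop :=
  Relation.ReflTransGen (fun a b => G.Adj a b ∧ ∀ j, C j ≠ b) u v

/-- `CopsWinInf G c C r`: with cops at positions `C`, an infinitely fast
robber at `r`, and the cops to move, the `c` cops can force a capture. -/
inductive CopsWinInf {V : Type*} (G : SimpleGraph V) (c : ℕ) :
    (Fin c → V) → V → Prop
  | catch (C C' : Fin c → V) (r : V) (hm : CopMove G C C') (i : Fin c)
      (hi : C' i = r) : CopsWinInf G c C r
  | step (C C' : Fin c → V) (r : V) (hm : CopMove G C C')
      (h : ∀ r', RobberMoveInf G C' r r' → CopsWinInf G c C' r') : CopsWinInf G c C r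

/-- The infinite-speed cop number: the least number of cops having a winning
strategy against an infinitely fast robber. -/
noncomputable def copNumberInf {V : Type*} (G : SimpleGraph V) : ℕ :=
  sInf {c : ℕ | ∃ C₀ : Fin c → V, ∀ r : V, CopsWinInf G c C₀ r}

open Finset in
/-- A counting argument: some function `V × Fin 20 → V` hits every set `B` containing a quarter of
the vertices from every set `A` containing a quarter of the vertices. -/
lemma exists_expanding_function (V : Type*) [Fintype V] [DecidableEq V] [Nonempty V] :
    ∃ g : V × Fin 20 → V, ∀ A B : Finset V,
      Fintype.card V ≤ 4 * #A → Fintype.card V ≤ 4 * #B → ∃ a ∈ A, ∃ i, g (a, i) ∈ B := by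
  classical
  by_contra! hcon
  set n := Fintype.card V with hn
  have hn0 : 0 < n := Fintype.card_pos
  let F : Finset V × Finset V → Finset (V × Fin 20 → V) := fun P =>
    Fintype.piFinset fun p => if p.1 ∈ P.1 then P.2ᶜ else univ
  let S : Finset (Finset V × Finset V) := univ.filter fun P => n ≤ 4 * #P.1 ∧ n ≤ 4 * #P.2
  have hcover : (univ : Finset (V × Fin 20 → V)) ⊆ S.biUnion F := by
    intro g _
    obtain ⟨A, B, hA, hB, h⟩ := hcon g
    simp only [mem_biUnion]
    refine ⟨(A, B), by simp [S, hA, hB], ?_⟩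
    simp only [F, Fintype.mem_piFinset]
    rintro ⟨a, i⟩
    by_cases ha : a ∈ A
    · simpa [ha] using h a ha i
    · simp [ha]
  have hF : ∀ P ∈ S, (#(F P) : ℝ) ≤ (243 / 1024 : ℝ) ^ n * (n : ℝ) ^ (n * 20) := by
    rintro ⟨A, B⟩ hP
    obtain ⟨hA, hB⟩ : n ≤ 4 * #A ∧ n ≤ 4 * #B := by simpa [S] using hP
    have hBc : (#Bᶜ : ℝ) ≤ 3 / 4 * n := by
      have h := card_add_card_compl B
      have h' : 4 * #Bᶜ ≤ 3 * n := by omega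
      have h'' : (4 * #Bᶜ : ℝ) ≤ 3 * n := by exact_mod_cast h'
      linarith
    calc (#(F (A, B)) : ℝ)
        = ∏ p : V × Fin 20, (#(if p.1 ∈ A then Bᶜ else univ) : ℝ) := by
          simp only [F, Fintype.card_piFinset]
          push_cast
          rfl
      _ ≤ ∏ p : V × Fin 20, ((if p.1 ∈ A then (3 / 4 : ℝ) else 1) * n) := by
          refine prod_le_prod (fun _ _ => by positivity) fun p _ => ?_
          split_ifs
          · exact hBc
          · simp [hn]
      _ = ((3 / 4 : ℝ) ^ 20) ^ #A * (n : ℝ) ^ (n * 20) := by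
          have h (w : V → ℝ) : ∏ p : V × Fin 20, w p.1 = (∏ v, w v) ^ 20 := by
            simp [Fintype.prod_prod_type, prod_pow]
          have hA' : ∏ v : V, (if v ∈ A then (3 / 4 : ℝ) else 1) = (3 / 4) ^ #A := by
            rw [prod_ite_mem, univ_inter, prod_const]
          rw [prod_mul_distrib, h fun v => if v ∈ A then (3 / 4 : ℝ) else 1, hA', prod_const,
            card_univ, Fintype.card_prod, Fintype.card_fin, ← pow_mul, ← pow_mul, mul_comm 20]
      _ = (243 / 1024 : ℝ) ^ (4 * #A) * (n : ℝ) ^ (n * 20) := by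
          rw [pow_mul (243 / 1024 : ℝ)]
          norm_num
      _ ≤ (243 / 1024 : ℝ) ^ n * (n : ℝ) ^ (n * 20) := by
          gcongr ?_ * _
          exact pow_le_pow_of_le_one (by norm_num) (by norm_num) hA
  have hS : (#S : ℝ) ≤ 4 ^ n := by
    have h : #S ≤ 4 ^ n := by
      refine (card_le_univ S).trans_eq ?_
      rw [Fintype.card_prod, Fintype.card_finset, ← hn, ← mul_pow]
      rfl
    exact_mod_cast h
  have htotal : (n : ℝ) ^ (n * 20) ≤ ∑ P ∈ S, (#(F P) : ℝ) := by
    have h := (card_le_card hcover).trans card_biUnion_le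
    rw [card_univ, Fintype.card_fun, Fintype.card_prod, Fintype.card_fin, ← hn] at h
    exact_mod_cast h
  have hpos : (0 : ℝ) < (n : ℝ) ^ (n * 20) := by positivity
  have hlt : (4 : ℝ) ^ n * (243 / 1024) ^ n < 1 := by
    rw [← mul_pow]
    exact pow_lt_one₀ (by norm_num) (by norm_num) hn0.ne'
  have hsum : ∑ P ∈ S, (#(F P) : ℝ) ≤ #S * ((243 / 1024 : ℝ) ^ n * (n : ℝ) ^ (n * 20)) := by
    simpa using sum_le_card_nsmul S _ _ hF
  have hle : (#S : ℝ) * ((243 / 1024 : ℝ) ^ n * (n : ℝ) ^ (n * 20)) ≤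
      4 ^ n * ((243 / 1024 : ℝ) ^ n * (n : ℝ) ^ (n * 20)) := by gcongr
  nlinarith

open Finset in
/-- If any two disjoint quarter-size subsets of `W` are joined by an edge and `W` contains at least
three quarters of the vertices, then `W` has a connected subset containing more than half of the
vertices. -/
lemma exists_large_connected_subset {V : Type*} [Fintype V] [DecidableEq V] (G : SimpleGraph V)
    (W : Finset V) (hW : 3 * Fintype.card V ≤ 4 * #W)
    (hE : ∀ A B : Finset V, A ⊆ W → B ⊆ W → Disjoint A B → Fintype.card V ≤ 4 * #A →
      Fintype.card V ≤ 4 * #B → ∃ a ∈ A, ∃ b ∈ B, G.Adj a b) :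
    ∃ K ⊆ W, Fintype.card V < 2 * #K ∧
      ∀ u ∈ K, ∀ v ∈ K, Relation.ReflTransGen (fun a b => G.Adj a b ∧ b ∈ K) u v := by
  classical
  let T : Finset (Finset V) := W.powerset.filter fun A =>
    Fintype.card V ≤ 4 * #A ∧ ∀ a ∈ A, ∀ b ∈ W, G.Adj a b → b ∈ A
  have hT : ∀ {A}, A ∈ T ↔ A ⊆ W ∧ Fintype.card V ≤ 4 * #A ∧
      ∀ a ∈ A, ∀ b ∈ W, G.Adj a b → b ∈ A := by simp [T]
  obtain ⟨A, hAT, hmin⟩ := T.exists_min_image card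
    ⟨W, hT.2 ⟨Subset.rfl, by omega, fun _ _ b hb _ => hb⟩⟩
  obtain ⟨hAW, hA, hclosed⟩ := hT.1 hAT
  have hlarge : Fintype.card V < 2 * #A := by
    have hB : 4 * #(W \ A) < Fintype.card V := by
      by_contra! h
      obtain ⟨a, ha, b, hb, hab⟩ := hE A (W \ A) hAW sdiff_subset disjoint_sdiff hA h
      rw [mem_sdiff] at hb
      exact hb.2 (hclosed a ha b hb.1 hab)
    have := card_sdiff_add_card_eq_card hAW
    omega
  refine ⟨A, hAW, hlarge, fun u hu => ?_⟩
  let R : Finset V := A.filter fun v =>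
    Relation.ReflTransGen (fun a b => G.Adj a b ∧ b ∈ A) u v
  have hR : ∀ {v}, v ∈ R ↔ v ∈ A ∧
      Relation.ReflTransGen (fun a b => G.Adj a b ∧ b ∈ A) u v := by simp [R]
  have hRA : R ⊆ A := filter_subset _ _
  have hcard := card_sdiff_add_card_eq_card hRA
  have huR : 0 < #R := card_pos.2 ⟨u, hR.2 ⟨hu, .refl⟩⟩
  have hRlarge : Fintype.card V ≤ 4 * #R := by
    by_contra! h
    have hmem : A \ R ∈ T := by
      refine hT.2 ⟨sdiff_subset.trans hAW, by omega, fun a ha b hb hab => ?_⟩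
      rw [mem_sdiff] at ha ⊢
      refine ⟨hclosed a ha.1 b hb hab, fun hbR => ha.2 ?_⟩
      exact hR.2 ⟨ha.1, (hR.1 hbR).2.tail ⟨hab.symm, ha.1⟩⟩
    have := hmin _ hmem
    omega
  have hRT : R ∈ T := by
    refine hT.2 ⟨hRA.trans hAW, hRlarge, fun a ha b hb hab => ?_⟩
    have hbA := hclosed a (hRA ha) b hb hab
    exact hR.2 ⟨hbA, (hR.1 ha).2.tail ⟨hab, hbA⟩⟩
  have hRA' : R = A := eq_of_subset_of_card_le hRA (hmin _ hRT)
  intro v hv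
  rw [← hRA'] at hv
  exact (hR.1 hv).2

open Finset in
/-- The robber escapes forever if, whatever the position of the cops, some connected set
containing more than half of the vertices avoids the closed neighbourhoods of the cops. -/
lemma not_copsWinInf_of_large_connected_set {V : Type*} [Fintype V] [DecidableEq V]
    (G : SimpleGraph V) (c : ℕ)
    (hK : ∀ C : Fin c → V, ∃ K : Finset V, Fintype.card V < 2 * #K ∧
      (∀ v ∈ K, ∀ i, v ≠ C i ∧ ¬ G.Adj (C i) v) ∧
      ∀ u ∈ K, ∀ v ∈ K, Relation.ReflTransGen (fun a b => G.Adj a b ∧ b ∈ K) u v) :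
    ¬ ∃ C₀ : Fin c → V, ∀ r : V, CopsWinInf G c C₀ r := by
  choose K hlarge havoid hconn using hK
  have key : ∀ C r, CopsWinInf G c C r → r ∉ K C := by
    intro C r h
    induction h
    · rename_i C C' r hm i hi
      intro hr
      obtain ⟨h1, h2⟩ := havoid C r hr i
      rcases hm i with h | h
      · exact h1 (hi.symm.trans h)
      · exact h2 (hi ▸ h)
    · rename_i C C' r hm _ ih
      intro hr
      obtain ⟨r', hr'⟩ : (K C ∩ K C').Nonempty := by
        rw [← card_pos]
        have h1 := card_union_add_card_inter (K C) (K C')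
        have h2 := card_le_univ (K C ∪ K C')
        have h3 := hlarge C
        have h4 := hlarge C'
        omega
      rw [mem_inter] at hr'
      refine ih r' ?_ hr'.2
      refine Relation.ReflTransGen.mono (fun a b hab => ⟨hab.1, fun j hj => ?_⟩)
        r r' (hconn C r hr r' hr'.1)
      obtain ⟨h1, h2⟩ := havoid C b hab.2 j
      rcases hm j with h | h
      · exact h1 (hj.symm.trans h)
      · exact h2 (hj ▸ h)
  rintro ⟨C₀, hC₀⟩
  obtain ⟨r, hr⟩ : (K C₀).Nonempty := by
    rw [← card_pos]
    have := hlarge C₀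
    omega
  exact key C₀ r (hC₀ r) hr

/-- Finitely many cops, one on each vertex, win. -/
lemma copsWinInf_nonempty (n : ℕ) (G : SimpleGraph (Fin n)) :
    {c : ℕ | ∃ C₀ : Fin c → Fin n, ∀ r, CopsWinInf G c C₀ r}.Nonempty :=
  ⟨n, id, fun r => .catch id id r (fun _ => .inl rfl) r rfl⟩

/-- The vertices whose fibre under `g` has at most `160` elements. -/
def lightVertices {V : Type*} [Fintype V] [DecidableEq V] (g : V × Fin 20 → V) : Finset V :=
  Finset.univ.filter fun v => (Finset.univ.filter fun p => g p = v).card ≤ 160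

/-- The graph of `g` on its light vertices. -/
def lightGraph {V : Type*} [Fintype V] [DecidableEq V] (g : V × Fin 20 → V) : SimpleGraph V :=
  SimpleGraph.fromRel fun u v => u ∈ lightVertices g ∧ v ∈ lightVertices g ∧ ∃ i, g (u, i) = v

open Finset in
lemma card_compl_lightVertices_le {V : Type*} [Fintype V] [DecidableEq V] (g : V × Fin 20 → V) :
    8 * #(lightVertices g)ᶜ ≤ Fintype.card V := by
  have h : #(lightVertices g)ᶜ * 161 ≤ #(univ : Finset (V × Fin 20)) := by
    rw [card_eq_sum_card_fiberwise (f := g) (t := univ) (by simp)]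
    refine le_trans ?_ (sum_le_sum_of_subset (subset_univ (lightVertices g)ᶜ))
    rw [← smul_eq_mul]
    refine card_nsmul_le_sum _ _ _ fun v hv => ?_
    simp only [lightVertices, mem_compl, mem_filter, mem_univ, true_and] at hv
    omega
  rw [card_univ, Fintype.card_prod, Fintype.card_fin] at h
  omega

open Finset in
/-- Closed neighbourhoods in the union of the light graph and the path have bounded size. -/
lemma exists_closed_neighborhood_cover {n : ℕ} (g : Fin n × Fin 20 → Fin n) (v : Fin n) :
    ∃ N : Finset (Fin n), #N ≤ 183 ∧ v ∈ N ∧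
      ∀ w, (lightGraph g ⊔ SimpleGraph.pathGraph n).Adj v w → w ∈ N := by
  classical
  let I : Finset (Fin n) := if v ∈ lightVertices g then
    (univ.filter fun p => g p = v).image Prod.fst else ∅
  let O : Finset (Fin n) := univ.image fun i => g (v, i)
  let P : Finset (Fin n) := univ.filter fun w => w.val = v.val
  let Q : Finset (Fin n) := univ.filter fun w => w.val = v.val + 1
  let Q' : Finset (Fin n) := univ.filter fun w => w.val + 1 = v.val
  have hI : #I ≤ 160 := by
    by_cases hv : v ∈ lightVertices g
    · simp only [I, hv, if_true]
      refine card_image_le.trans ?_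
      simpa [lightVertices] using hv
    · simp [I, hv]
  have hO : #O ≤ 20 := card_image_le.trans (by simp)
  have hP : #P ≤ 1 := card_le_one.2 fun a ha b hb => by
    simp only [P, mem_filter, mem_univ, true_and] at ha hb; omega
  have hQ : #Q ≤ 1 := card_le_one.2 fun a ha b hb => by
    simp only [Q, mem_filter, mem_univ, true_and] at ha hb; omega
  have hQ' : #Q' ≤ 1 := card_le_one.2 fun a ha b hb => by
    simp only [Q', mem_filter, mem_univ, true_and] at ha hb; omega
  refine ⟨I ∪ (O ∪ (P ∪ (Q ∪ Q'))), ?_, by simp [P], fun w hw => ?_⟩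
  · have h1 := card_union_le I (O ∪ (P ∪ (Q ∪ Q')))
    have h2 := card_union_le O (P ∪ (Q ∪ Q'))
    have h3 := card_union_le P (Q ∪ Q')
    have h4 := card_union_le Q Q'
    omega
  · rw [SimpleGraph.sup_adj] at hw
    simp only [mem_union]
    rcases hw with hw | hw
    · rw [lightGraph, SimpleGraph.fromRel_adj] at hw
      obtain ⟨-, ⟨-, -, i, hi⟩ | ⟨-, hv, i, hi⟩⟩ := hw
      · right; left
        exact mem_image.2 ⟨i, mem_univ _, hi⟩
      · left
        simp only [I, hv, if_true]
        exact mem_image.2 ⟨(w, i), by simpa using hi, rfl⟩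
    · rw [SimpleGraph.pathGraph_adj] at hw
      right; right; right
      rcases hw with h | h
      · left; simp [Q, h]
      · right; simp [Q', h]

/-- For every sufficiently large `n` there is a connected graph on `n`
vertices whose infinite-speed cop number is at least `n / 800²`. -/
theorem copNumberInf_lower_bound :
    ∃ N : ℕ, ∀ n : ℕ, N ≤ n →
      ∃ G : SimpleGraph (Fin n), G.Connected ∧
        (n : ℝ) / 800 ^ 2 ≤ (copNumberInf G : ℝ) := by
  classical
  refine ⟨1, fun n hn => ?_⟩
  obtain ⟨m, rfl⟩ : ∃ m, n = m + 1 := ⟨n - 1, by omega⟩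
  obtain ⟨g, hg⟩ := exists_expanding_function (Fin (m + 1))
  set G := lightGraph g ⊔ SimpleGraph.pathGraph (m + 1) with hG
  refine ⟨G, (SimpleGraph.pathGraph_connected m).mono le_sup_right, ?_⟩
  by_contra! hlt
  have hwin : ∃ C₀ : Fin (copNumberInf G) → Fin (m + 1), ∀ r, CopsWinInf G _ C₀ r :=
    Nat.sInf_mem (copsWinInf_nonempty (m + 1) G)
  generalize copNumberInf G = c at hlt hwin
  have hc : 640000 * c < m + 1 := by
    rw [lt_div_iff₀ (by norm_num)] at hlt
    have h : (640000 * c : ℝ) < ((m + 1 : ℕ) : ℝ) := by linarith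
    exact_mod_cast h
  refine not_copsWinInf_of_large_connected_set G c (fun C => ?_) hwin
  choose N hN hself hadj using exists_closed_neighborhood_cover g
  let S : Finset (Fin (m + 1)) := Finset.univ.biUnion fun i => N (C i)
  have hS : S.card ≤ c * 183 := by
    simpa using Finset.card_biUnion_le_card_mul Finset.univ (fun i => N (C i)) 183
      fun i _ => hN (C i)
  have hmemS : ∀ i, N (C i) ⊆ S := fun i =>
    Finset.subset_biUnion_of_mem (fun i => N (C i)) (Finset.mem_univ i)
  obtain ⟨K, hKW, hlarge, hconn⟩ := exists_large_connected_subset G (lightVertices g \ S)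
    (by
      have h1 := card_compl_lightVertices_le g
      have h2 := Finset.card_add_card_compl (lightVertices g)
      have h3 := Finset.le_card_sdiff S (lightVertices g)
      rw [Fintype.card_fin] at h1 h2 ⊢
      omega)
    (by
      intro A B hA hB hAB hAc hBc
      obtain ⟨a, ha, i, hi⟩ := hg A B hAc hBc
      refine ⟨a, ha, g (a, i), hi, ?_⟩
      rw [hG, SimpleGraph.sup_adj, lightGraph, SimpleGraph.fromRel_adj]
      exact .inl ⟨fun h => Finset.disjoint_left.1 hAB ha (h ▸ hi),
        .inl ⟨(Finset.mem_sdiff.1 (hA ha)).1, (Finset.mem_sdiff.1 (hB hi)).1, i, rfl⟩⟩)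
  refine ⟨K, hlarge, fun v hv i => ?_, hconn⟩
  have hvS := (Finset.mem_sdiff.1 (hKW hv)).2
  exact ⟨fun h => hvS (hmemS i (h ▸ hself (C i))), fun h => hvS (hmemS i (hadj (C i) v h))⟩
end

section
/- Let G be a connected graph on n vertices and let v be a vertex of G of maximum degree Δ. Let U₁, …, U_k be the vertex sets of the connected components of the graph obtained from G by deleting v together with all its neighbors. Then each |U_i| ≤ n - 1 - Δ, and c(G) ≤ 1 + max_i c(G[U_i]) (where the maximum is interpreted as 0 if there are no components, so that c(G) ≤ 1 in that case). -/
/-- A graph with at least one vertex cannot be won by zero cops. -/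
theorem CopsWin.pos {V : Type*} {G : SimpleGraph V} {c : ℕ} {C : Fin c → V} {r : V}
    (h : CopsWin G c C r) : 0 < c := by
  induction h
  next C C' r hm i hi => exact i.pos
  next C C' r hm h ih => exact ih r (Or.inl rfl)

/-- The infimum defining the cop number of a finite graph is attained. -/
theorem exists_copsWin_copNumber {V : Type*} [Finite V] (G : SimpleGraph V) :
    ∃ C₀ : Fin (copNumber G) → V, ∀ r : V, CopsWin G (copNumber G) C₀ r := by
  obtain ⟨n, ⟨e⟩⟩ := Finite.exists_equiv_fin V
  refine Nat.sInf_mem (s := {c : ℕ | ∃ C₀ : Fin c → V, ∀ r : V, CopsWin G c C₀ r})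
    ⟨n, e.symm, fun r => ?_⟩
  exact CopsWin.catch _ _ r (fun _ => Or.inl rfl) (e r) (e.symm_apply_apply r)

theorem CopMove.cons {V : Type*} {G : SimpleGraph V} {m : ℕ} {D D' : Fin m → V} (v : V)
    (h : CopMove G D D') :
    CopMove G (Fin.cons v D : Fin (m + 1) → V) (Fin.cons v D' : Fin (m + 1) → V) := by
  intro i
  cases i using Fin.cases with
  | zero => exact Or.inl rfl
  | succ j => simpa using h j

/-- A cop adjacent to the robber captures it. -/
theorem copsWin_cons_of_adj {V : Type*} {G : SimpleGraph V} {m : ℕ} (D : Fin m → V) {v r : V}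
    (h : r = v ∨ G.Adj v r) : CopsWin G (m + 1) (Fin.cons v D : Fin (m + 1) → V) r := by
  refine CopsWin.catch _ (Fin.cons r D : Fin (m + 1) → V) r (fun i => ?_) 0 rfl
  cases i using Fin.cases with
  | zero => simpa using h
  | succ j => exact Or.inl rfl

/-- While a cop guards `v`, a robber that can leave `S` only through the neighbourhood of `v` is
captured by cops following a winning strategy inside `S`. -/
theorem CopsWin.cons_of_induce {V : Type*} {G : SimpleGraph V} {S : Set V} {v : V}
    (hS : ∀ r ∈ S, ∀ r', G.Adj r r' → r' ∈ S ∨ r' = v ∨ G.Adj v r') {c m : ℕ} {f : Fin m → Fin c}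
    (hf : Function.Surjective f) {C : Fin c → S} {r : S} (h : CopsWin (G.induce S) c C r) :
    CopsWin G (m + 1) (Fin.cons v (fun j => (C (f j) : V)) : Fin (m + 1) → V) r := by
  have lift : ∀ {C C' : Fin c → S}, CopMove (G.induce S) C C' →
      CopMove G (fun j => (C (f j) : V)) (fun j => (C' (f j) : V)) := fun hm j =>
    (hm (f j)).imp (congrArg Subtype.val) id
  induction h
  next C C' r hm i hi =>
    obtain ⟨j, rfl⟩ := hf i
    exact CopsWin.catch _ _ _ ((lift hm).cons v) j.succ (by simp [hi])
  next C C' r hm h ih =>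
    refine CopsWin.step _ _ _ ((lift hm).cons v) fun r' hr' => ?_
    have hr'S : r' ∈ S ∨ r' = v ∨ G.Adj v r' := by
      rcases hr' with rfl | hadj
      · exact Or.inl r.2
      · exact hS r r.2 r' hadj
    rcases hr'S with hmem | hv
    · exact ih ⟨r', hmem⟩ (hr'.imp (fun e => Subtype.ext e) id)
    · exact copsWin_cons_of_adj _ hv

/-- While a cop guards `v`, the other cops may walk to any target positions `T` before starting
to chase a robber that can leave `S` only through the neighbourhood of `v`. -/
theorem copsWin_cons_of_dist_le {V : Type*} {G : SimpleGraph V} (hconn : G.Connected) {S : Set V}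
    {v : V} (hS : ∀ r ∈ S, ∀ r', G.Adj r r' → r' ∈ S ∨ r' = v ∨ G.Adj v r') {m : ℕ}
    {T : Fin m → V} (hT : ∀ r ∈ S, CopsWin G (m + 1) (Fin.cons v T : Fin (m + 1) → V) r)
    (N : ℕ) (D : Fin m → V) (hD : ∀ j, G.dist (D j) (T j) ≤ N) (r : V) (hr : r ∈ S) :
    CopsWin G (m + 1) (Fin.cons v D : Fin (m + 1) → V) r := by
  induction N generalizing D r with
  | zero =>
    have hDT : D = T := funext fun j => hconn.dist_eq_zero_iff.mp (Nat.le_zero.mp (hD j))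
    exact hDT ▸ hT r hr
  | succ N ih =>
    have hstep : ∀ j, ∃ w, (w = D j ∨ G.Adj (D j) w) ∧ G.dist w (T j) ≤ N := by
      intro j
      obtain ⟨p, hp⟩ := hconn.exists_walk_length_eq_dist (D j) (T j)
      have hle := hp.trans_le (hD j)
      generalize D j = a at p hle
      cases p with
      | nil => exact ⟨_, Or.inl rfl, by simp⟩
      | cons hadj q =>
        refine ⟨_, Or.inr hadj, (SimpleGraph.dist_le q).trans ?_⟩
        simpa using hle
    choose D' hmove hdist using hstep
    refine CopsWin.step _ _ r (CopMove.cons v hmove) fun r' hr' => ?_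
    have hr'S : r' ∈ S ∨ r' = v ∨ G.Adj v r' := by
      rcases hr' with rfl | hadj
      · exact Or.inl hr
      · exact hS r hr r' hadj
    rcases hr'S with hmem | hv
    · exact ih D' hdist r' hmem
    · exact copsWin_cons_of_adj _ hv

/-- A component of an induced subgraph can only be left through the deleted vertices. -/
theorem mem_image_supp_of_adj {V : Type*} {G : SimpleGraph V} {W : Set V}
    (comp : (G.induce W).ConnectedComponent) {r r' : V} (hr : r ∈ Subtype.val '' comp.supp)
    (hadj : G.Adj r r') (hr' : r' ∈ W) : r' ∈ Subtype.val '' comp.supp := by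
  obtain ⟨x, hx, rfl⟩ := hr
  refine ⟨⟨r', hr'⟩, ?_, rfl⟩
  have hxr : (G.induce W).Adj x ⟨r', hr'⟩ := hadj
  exact comp.mem_supp_of_adj_mem_supp hx hxr

/-- Lemma 1(i): if `v` is a vertex of maximum degree `Δ` in a connected graph
`G` on `n` vertices, and `U₁, …, U_k` are the vertex sets of the connected
components of `G` minus the closed neighbourhood of `v`, then every
`|U_i| ≤ n - 1 - Δ` and `c(G) ≤ 1 + max_i c(G[U_i])` (the maximum of the
empty set being `0`). -/
theorem copNumber_max_degree_reduction {V : Type} [Fintype V] (G : SimpleGraph V)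
    (n : ℕ) (hn : Fintype.card V = n) (hconn : G.Connected)
    (v : V) (Δ : ℕ) (hΔ : (G.neighborSet v).ncard = Δ)
    (hmax : ∀ w : V, (G.neighborSet w).ncard ≤ Δ) :
    (∀ comp : (G.induce ((insert v (G.neighborSet v))ᶜ)).ConnectedComponent,
        (Subtype.val '' comp.supp).ncard ≤ n - 1 - Δ) ∧
      copNumber G ≤ 1 + sSup (Set.range
        fun comp : (G.induce ((insert v (G.neighborSet v))ᶜ)).ConnectedComponent =>
          copNumber (G.induce (Subtype.val '' comp.supp))) := by
  constructor
  · intro comp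
    have hsub : Subtype.val '' comp.supp ⊆ (insert v (G.neighborSet v))ᶜ := by
      rintro _ ⟨x, -, rfl⟩
      exact x.2
    have hle := Set.ncard_le_ncard hsub
    rw [Set.ncard_compl, Set.ncard_insert_of_notMem (by simp), Nat.card_eq_fintype_card, hn,
      hΔ] at hle
    omega
  · rw [add_comm 1]
    set m := sSup (Set.range
        fun comp : (G.induce ((insert v (G.neighborSet v))ᶜ)).ConnectedComponent =>
          copNumber (G.induce (Subtype.val '' comp.supp)))
    refine Nat.sInf_le ⟨(Fin.cons v fun _ => v : Fin (m + 1) → V), fun r => ?_⟩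
    by_cases hr : r ∈ insert v (G.neighborSet v)
    · exact copsWin_cons_of_adj _ hr
    let comp := (G.induce ((insert v (G.neighborSet v))ᶜ)).connectedComponentMk ⟨r, hr⟩
    have hrS : r ∈ Subtype.val '' comp.supp := ⟨⟨r, hr⟩, rfl, rfl⟩
    have hS : ∀ x ∈ Subtype.val '' comp.supp, ∀ y, G.Adj x y →
        y ∈ Subtype.val '' comp.supp ∨ y = v ∨ G.Adj v y := by
      intro x hx y hxy
      by_cases hy : y ∈ insert v (G.neighborSet v)
      · exact Or.inr hy
      · exact Or.inl (mem_image_supp_of_adj comp hx hxy hy)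
    obtain ⟨C₀, hC₀⟩ := exists_copsWin_copNumber (G.induce (Subtype.val '' comp.supp))
    have hle : copNumber (G.induce (Subtype.val '' comp.supp)) ≤ m :=
      le_csSup (Set.finite_range _).bddAbove ⟨comp, rfl⟩
    have hpos := (hC₀ ⟨r, hrS⟩).pos
    have : Nonempty (Fin (copNumber (G.induce (Subtype.val '' comp.supp)))) := ⟨⟨0, hpos⟩⟩
    have hf := Function.invFun_surjective (Fin.castLE_injective hle)
    exact copsWin_cons_of_dist_le hconn hS
      (fun x hx => CopsWin.cons_of_induce hS hf (hC₀ ⟨x, hx⟩)) _ _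
      (fun j => Finset.le_sup (f := fun j => G.dist v (C₀ (Function.invFun (Fin.castLE hle) j)))
        (Finset.mem_univ j)) r hrS
end
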